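/- arXiv:1005.0682 — 6 statements merged into one kernel-verified Lean document; each statement's English description precedes it below -/
import Mathlib

section
/- Let Λ be a lattice in ℝ² and let A : ℝ² → ℝ² be an ℝ-linear isometry with det A = −1 (an orthogonal reflection, so A² = id) such that A(Λ) = Λ. Then there exists a ℤ-basis (b₁, b₂) of Λ such that either (A b₁ = b₁ and A b₂ = −b₂) or (A b₁ = b₂ and A b₂ = b₁). (In the paper's language: the group ⟨A⟩ in Iso(ℝ², Λ) is linearly conjugate to D₁ or to D_{1,4} in Iso(ℝ², ℤ²).) -/
/-- `Λ` is a lattice in the Euclidean plane: the additive subgroup generated by two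
`ℝ`-linearly independent vectors. -/
def IsLattice (Λ : AddSubgroup (EuclideanSpace ℝ (Fin 2))) : Prop :=
  ∃ v₁ v₂ : EuclideanSpace ℝ (Fin 2),
    LinearIndependent ℝ ![v₁, v₂] ∧ Λ = AddSubgroup.closure {v₁, v₂}

/-- `(b₁, b₂)` is a `ℤ`-basis of `Λ`: both belong to `Λ`, and every element of `Λ` is
uniquely an integer linear combination of `b₁` and `b₂`. -/
def IsZBasis (Λ : AddSubgroup (EuclideanSpace ℝ (Fin 2)))
    (b₁ b₂ : EuclideanSpace ℝ (Fin 2)) : Prop :=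
  b₁ ∈ Λ ∧ b₂ ∈ Λ ∧ ∀ w ∈ Λ, ∃! p : ℤ × ℤ, w = p.1 • b₁ + p.2 • b₂

theorem isZBasis_closure_pair {v₁ v₂ : EuclideanSpace ℝ (Fin 2)}
    (hv : LinearIndependent ℝ ![v₁, v₂]) :
    IsZBasis (AddSubgroup.closure {v₁, v₂}) v₁ v₂ := by
  refine ⟨AddSubgroup.subset_closure (by simp), AddSubgroup.subset_closure (by simp), ?_⟩
  intro w hw
  obtain ⟨i, j, rfl⟩ := AddSubgroup.mem_closure_pair.mp hw
  refine ⟨(i, j), rfl, ?_⟩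
  rintro ⟨m, n⟩ h
  have h' : ((i - m : ℤ) : ℝ) • v₁ + ((j - n : ℤ) : ℝ) • v₂ = 0 := by
    simp only [Int.cast_smul_eq_zsmul, sub_smul]
    rw [← sub_eq_zero.mpr h]
    module
  obtain ⟨h₁, h₂⟩ := LinearIndependent.pair_iff.mp hv _ _ h'
  rw [Int.cast_eq_zero] at h₁ h₂
  ext <;> simp only <;> omega

/-- A unimodular change of coordinates turns a `ℤ`-basis into a `ℤ`-basis. -/
theorem IsZBasis.change {Λ : AddSubgroup (EuclideanSpace ℝ (Fin 2))}
    {b₁ b₂ : EuclideanSpace ℝ (Fin 2)} (hb : IsZBasis Λ b₁ b₂) {x y z t : ℤ}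
    (hdet : x * t - y * z = 1) :
    IsZBasis Λ (x • b₁ + y • b₂) (z • b₁ + t • b₂) := by
  obtain ⟨h₁, h₂, h⟩ := hb
  have hmem (m n : ℤ) : m • b₁ + n • b₂ ∈ Λ :=
    Λ.add_mem (Λ.zsmul_mem h₁ m) (Λ.zsmul_mem h₂ n)
  refine ⟨hmem x y, hmem z t, fun w hw => ?_⟩
  obtain ⟨⟨i, j⟩, hij, huniq⟩ := h w hw
  refine ⟨(i * t - j * z, j * x - i * y), ?_, ?_⟩
  · simp only [hij]
    match_scalars
    · linear_combination -i * hdet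
    · linear_combination -j * hdet
  · rintro ⟨m, n⟩ hmn
    have := huniq (m * x + n * z, m * y + n * t) (by
      simp only [hmn]
      module)
    simp only [Prod.mk.injEq] at this ⊢
    obtain ⟨rfl, rfl⟩ := this
    constructor
    · linear_combination -m * hdet
    · linear_combination -n * hdet

theorem LinearIsometryEquiv.apply_apply_of_det_eq_neg_one
    (A : EuclideanSpace ℝ (Fin 2) ≃ₗᵢ[ℝ] EuclideanSpace ℝ (Fin 2))
    (hdet : LinearMap.det (A.toLinearEquiv :
      EuclideanSpace ℝ (Fin 2) →ₗ[ℝ] EuclideanSpace ℝ (Fin 2)) = -1)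
    (v : EuclideanSpace ℝ (Fin 2)) : A (A v) = v := by
  let e := EuclideanSpace.basisFun (Fin 2) ℝ
  have hnorm (i : Fin 2) : (A (e i) 0) ^ 2 + (A (e i) 1) ^ 2 = 1 := by
    have h := EuclideanSpace.norm_sq_eq (A (e i))
    rw [A.norm_map, e.norm_eq_one] at h
    simpa [Fin.sum_univ_two] using h.symm
  rw [← LinearMap.det_toMatrix e.toBasis, Matrix.det_fin_two] at hdet
  simp only [LinearMap.toMatrix_apply, OrthonormalBasis.coe_toBasis,
    OrthonormalBasis.coe_toBasis_repr_apply, LinearEquiv.coe_coe,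
    LinearIsometryEquiv.coe_toLinearEquiv] at hdet
  change A (e 0) 0 * A (e 1) 1 - A (e 1) 0 * A (e 0) 1 = -1 at hdet
  have h₀ := hnorm 0
  have h₁ := hnorm 1
  have hA (u : EuclideanSpace ℝ (Fin 2)) : A u = u 0 • A (e 0) + u 1 • A (e 1) := by
    conv_lhs => rw [← e.sum_repr u]
    simp [Fin.sum_univ_two, e]
  have hsq : (A (e 0) 0 + A (e 1) 1) ^ 2 + (A (e 1) 0 - A (e 0) 1) ^ 2 = 0 := by
    linear_combination h₀ + h₁ + 2 * hdet
  have htr : A (e 1) 1 = -A (e 0) 0 := by nlinarith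
  have hsymm : A (e 1) 0 = A (e 0) 1 := by nlinarith
  rw [hA (A v), hA v]
  ext i
  fin_cases i
  · simp [htr, hsymm]
    linear_combination v 0 * h₀
  · simp [htr, hsymm]
    linear_combination v 1 * h₀

theorem LinearIsometryEquiv.det_eq_one_of_apply_eq_smul
    (A : EuclideanSpace ℝ (Fin 2) ≃ₗᵢ[ℝ] EuclideanSpace ℝ (Fin 2))
    {v₁ v₂ : EuclideanSpace ℝ (Fin 2)} (hv : LinearIndependent ℝ ![v₁, v₂])
    {c : ℝ} (hc : c ^ 2 = 1) (h₁ : A v₁ = c • v₁) (h₂ : A v₂ = c • v₂) :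
    LinearMap.det (A.toLinearEquiv :
      EuclideanSpace ℝ (Fin 2) →ₗ[ℝ] EuclideanSpace ℝ (Fin 2)) = 1 := by
  have hA : (A.toLinearEquiv : EuclideanSpace ℝ (Fin 2) →ₗ[ℝ] EuclideanSpace ℝ (Fin 2))
      = c • LinearMap.id := by
    refine (basisOfLinearIndependentOfCardEqFinrank hv (by simp)).ext fun i => ?_
    fin_cases i
    · simpa using h₁
    · simpa using h₂
  rw [hA, LinearMap.det_smul]
  simpa using hc

/-- A lattice preserved by a plane reflection contains a nonzero fixed vector. -/
theorem IsZBasis.exists_fixed_ne_zero {Λ : AddSubgroup (EuclideanSpace ℝ (Fin 2))}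
    {v₁ v₂ : EuclideanSpace ℝ (Fin 2)} (hb : IsZBasis Λ v₁ v₂)
    (hv : LinearIndependent ℝ ![v₁, v₂])
    (A : EuclideanSpace ℝ (Fin 2) ≃ₗᵢ[ℝ] EuclideanSpace ℝ (Fin 2))
    (hdet : LinearMap.det (A.toLinearEquiv :
      EuclideanSpace ℝ (Fin 2) →ₗ[ℝ] EuclideanSpace ℝ (Fin 2)) = -1)
    (hA : ∀ w ∈ Λ, A w ∈ Λ) : ∃ u ∈ Λ, u ≠ 0 ∧ A u = u := by
  by_contra! h
  have hneg (w) (hw : w ∈ Λ) : A w = (-1 : ℝ) • w := by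
    by_contra hne
    refine h (A w + w) (Λ.add_mem (hA w hw) hw) (fun h0 => hne ?_) ?_
    · rw [neg_one_smul]
      exact eq_neg_of_add_eq_zero_left h0
    · rw [map_add, A.apply_apply_of_det_eq_neg_one hdet, add_comm]
  have := A.det_eq_one_of_apply_eq_smul hv (by norm_num) (hneg v₁ hb.1) (hneg v₂ hb.2.1)
  linarith

/-- A lattice preserved by a plane reflection has a `ℤ`-basis whose first vector is fixed. -/
theorem IsZBasis.exists_fixed_left {Λ : AddSubgroup (EuclideanSpace ℝ (Fin 2))}
    {v₁ v₂ : EuclideanSpace ℝ (Fin 2)} (hb : IsZBasis Λ v₁ v₂)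
    (hv : LinearIndependent ℝ ![v₁, v₂])
    (A : EuclideanSpace ℝ (Fin 2) ≃ₗᵢ[ℝ] EuclideanSpace ℝ (Fin 2))
    (hdet : LinearMap.det (A.toLinearEquiv :
      EuclideanSpace ℝ (Fin 2) →ₗ[ℝ] EuclideanSpace ℝ (Fin 2)) = -1)
    (hA : ∀ w ∈ Λ, A w ∈ Λ) : ∃ p q, IsZBasis Λ p q ∧ A p = p := by
  obtain ⟨u, hu, hu0, hAu⟩ := hb.exists_fixed_ne_zero hv A hdet hA
  obtain ⟨⟨s, t⟩, hst, -⟩ := hb.2.2 u hu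
  simp only at hst
  have hg : 0 < Int.gcd s t := by
    rw [Int.gcd_pos_iff]
    by_contra! h0
    exact hu0 (by simp [hst, h0.1, h0.2])
  obtain ⟨s', t', hcop, hs, ht⟩ := Int.exists_gcd_one hg
  obtain ⟨α, β, hαβ⟩ := Int.isCoprime_iff_gcd_eq_one.mpr hcop
  refine ⟨s' • v₁ + t' • v₂, -β • v₁ + α • v₂,
    hb.change (by linear_combination hαβ), ?_⟩
  generalize Int.gcd s t = g at hg hs ht
  have hup : u = (g : ℝ) • (s' • v₁ + t' • v₂) := by
    rw [hst, hs, ht]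
    module
  have hg0 : (g : ℝ) ≠ 0 := by exact_mod_cast hg.ne'
  rw [hup, map_smul] at hAu
  exact smul_right_injective _ hg0 hAu

theorem IsZBasis.exists_apply_right {Λ : AddSubgroup (EuclideanSpace ℝ (Fin 2))}
    {p q : EuclideanSpace ℝ (Fin 2)} (hb : IsZBasis Λ p q)
    (A : EuclideanSpace ℝ (Fin 2) ≃ₗᵢ[ℝ] EuclideanSpace ℝ (Fin 2))
    (hdet : LinearMap.det (A.toLinearEquiv :
      EuclideanSpace ℝ (Fin 2) →ₗ[ℝ] EuclideanSpace ℝ (Fin 2)) = -1)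
    (hA : ∀ w ∈ Λ, A w ∈ Λ) (hspan : ∃ v₁ ∈ Λ, ∃ v₂ ∈ Λ, LinearIndependent ℝ ![v₁, v₂])
    (hp : A p = p) : ∃ n : ℤ, A q = n • p - q := by
  obtain ⟨⟨n, m⟩, hnm, -⟩ := hb.2.2 (A q) (hA q hb.2.1)
  simp only at hnm
  have hAA := A.apply_apply_of_det_eq_neg_one hdet q
  rw [hnm, map_add, map_zsmul, map_zsmul, hp, hnm] at hAA
  have huniq := (hb.2.2 q hb.2.1).unique (y₁ := (n + m * n, m * m)) (y₂ := (0, 1))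
    (by
      nth_rewrite 1 [← hAA]
      simp only
      module) (by simp)
  simp only [Prod.mk.injEq] at huniq
  obtain ⟨hn, hm⟩ := huniq
  rcases mul_self_eq_one_iff.mp hm with rfl | rfl
  · obtain rfl : n = 0 := by omega
    have hid (w) (hw : w ∈ Λ) : A w = (1 : ℝ) • w := by
      obtain ⟨⟨i, j⟩, rfl, -⟩ := hb.2.2 w hw
      simp [map_add, map_zsmul, hp, hnm]
    obtain ⟨v₁, hv₁, v₂, hv₂, hv⟩ := hspan
    have := A.det_eq_one_of_apply_eq_smul hv (by norm_num) (hid v₁ hv₁) (hid v₂ hv₂)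
    linarith
  · exact ⟨n, by rw [hnm]; module⟩

/-- If `A` is a linear isometry of `ℝ²` with `det A = -1` preserving a
lattice `Λ`, then `Λ` has a `ℤ`-basis `(b₁, b₂)` with either `A b₁ = b₁, A b₂ = -b₂`
(type `D₁`) or `A b₁ = b₂, A b₂ = b₁` (type `D_{1,4}`). -/
theorem stmt_0 (Λ : AddSubgroup (EuclideanSpace ℝ (Fin 2))) (hΛ : IsLattice Λ)
    (A : EuclideanSpace ℝ (Fin 2) ≃ₗᵢ[ℝ] EuclideanSpace ℝ (Fin 2))
    (hdet : LinearMap.det (A.toLinearEquiv :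
      EuclideanSpace ℝ (Fin 2) →ₗ[ℝ] EuclideanSpace ℝ (Fin 2)) = -1)
    (hAΛ : ⇑A '' (Λ : Set (EuclideanSpace ℝ (Fin 2))) = (Λ : Set (EuclideanSpace ℝ (Fin 2)))) :
    ∃ b₁ b₂ : EuclideanSpace ℝ (Fin 2), IsZBasis Λ b₁ b₂ ∧
      ((A b₁ = b₁ ∧ A b₂ = -b₂) ∨ (A b₁ = b₂ ∧ A b₂ = b₁)) := by
  obtain ⟨v₁, v₂, hv, rfl⟩ := hΛ
  have hb := isZBasis_closure_pair hv
  have hA (w) (hw : w ∈ AddSubgroup.closure {v₁, v₂}) :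
      A w ∈ AddSubgroup.closure {v₁, v₂} := by
    have : A w ∈ A '' (AddSubgroup.closure {v₁, v₂} : Set _) := ⟨w, hw, rfl⟩
    rwa [hAΛ] at this
  obtain ⟨p, q, hpq, hp⟩ := hb.exists_fixed_left hv A hdet hA
  obtain ⟨n, hq⟩ := hpq.exists_apply_right A hdet hA ⟨v₁, hb.1, v₂, hb.2.1, hv⟩ hp
  obtain ⟨k, rfl | rfl⟩ := Int.even_or_odd' n
  · refine ⟨_, _, hpq.change (x := 1) (y := 0) (z := -k) (t := 1) (by ring), Or.inl ⟨?_, ?_⟩⟩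
    · simp [hp]
    · simp only [map_add, map_zsmul, hp, hq]
      module
  · refine ⟨_, _, hpq.change (x := 1 + k) (y := -1) (z := -k) (t := 1) (by ring),
      Or.inr ⟨?_, ?_⟩⟩
    · simp only [map_add, map_zsmul, hp, hq]
      module
    · simp only [map_add, map_zsmul, hp, hq]
      module
end

section
/- Let Λ be a lattice in ℝ² and let r be the minimum of ‖w‖ over w ∈ Λ \ {0} (this minimum exists since Λ is discrete). If w₁, w₂ ∈ Λ are ℝ-linearly independent and ‖w₁‖ = ‖w₂‖ = r, then (w₁, w₂) is a ℤ-basis of Λ. -/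
open scoped InnerProductSpace in
/-- For linearly independent vectors of equal norm, a linear combination whose coefficients
are at most `1 / 2` in absolute value is strictly shorter than the two vectors. -/
lemma norm_smul_add_smul_lt_of_abs_le_half {E : Type*} [NormedAddCommGroup E]
    [InnerProductSpace ℝ E] {x y : E} {r s t : ℝ} (hind : LinearIndependent ℝ ![x, y])
    (hx : ‖x‖ = r) (hy : ‖y‖ = r) (hs : |s| ≤ 1 / 2) (ht : |t| ≤ 1 / 2) :
    ‖s • x + t • y‖ < r := by
  have hr : 0 ≤ r := hx ▸ norm_nonneg x
  rw [LinearIndependent.pair_iff] at hind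
  have expand (a b : ℝ) :
      ‖a • x + b • y‖ ^ 2 = (a ^ 2 + b ^ 2) * r ^ 2 + 2 * (a * b) * ⟪x, y⟫_ℝ := by
    rw [norm_add_sq_real, norm_smul, norm_smul, real_inner_smul_left, real_inner_smul_right,
      hx, hy, mul_pow, mul_pow, Real.norm_eq_abs, Real.norm_eq_abs, sq_abs, sq_abs]
    ring
  have pos {b : ℝ} : 0 < ‖(1 : ℝ) • x + b • y‖ ^ 2 :=
    pow_pos (norm_pos_iff.2 fun h => one_ne_zero (hind 1 b h).1) 2
  have hc : |⟪x, y⟫_ℝ| < r ^ 2 := by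
    have hadd := (expand 1 1).symm ▸ pos (b := 1)
    have hsub := (expand 1 (-1)).symm ▸ pos (b := -1)
    rw [abs_lt]
    constructor <;> linarith
  have hst : s ^ 2 + t ^ 2 ≤ 1 / 2 := by
    have hs' := sq_le_sq' (abs_le.1 hs).1 (abs_le.1 hs).2
    have ht' := sq_le_sq' (abs_le.1 ht).1 (abs_le.1 ht).2
    linarith
  have hcross : 2 * (s * t) * ⟪x, y⟫_ℝ ≤ (s ^ 2 + t ^ 2) * |⟪x, y⟫_ℝ| := by
    refine (le_abs_self _).trans ?_
    rw [abs_mul]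
    gcongr
    rw [abs_le]
    constructor <;> nlinarith [sq_nonneg (s + t), sq_nonneg (s - t)]
  refine lt_of_pow_lt_pow_left₀ 2 hr ?_
  rw [expand]
  nlinarith [mul_le_mul_of_nonneg_right hst (add_nonneg (sq_nonneg r) (abs_nonneg ⟪x, y⟫_ℝ))]

/-- If `w₁, w₂` are linearly independent elements of a lattice `Λ ⊆ ℝ²`
both of whose norms equal the minimum `r` of the norms of nonzero lattice vectors, then
`(w₁, w₂)` is a `ℤ`-basis of `Λ`. -/
theorem stmt_1 (Λ : AddSubgroup (EuclideanSpace ℝ (Fin 2))) (hΛ : IsLattice Λ)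
    (r : ℝ) (hr : ∀ w ∈ Λ, w ≠ 0 → r ≤ ‖w‖)
    (w₁ w₂ : EuclideanSpace ℝ (Fin 2)) (hw₁ : w₁ ∈ Λ) (hw₂ : w₂ ∈ Λ)
    (hind : LinearIndependent ℝ ![w₁, w₂])
    (hn₁ : ‖w₁‖ = r) (hn₂ : ‖w₂‖ = r) :
    ∀ w ∈ Λ, ∃! p : ℤ × ℤ, w = p.1 • w₁ + p.2 • w₂ := by
  intro w hw
  have hspan := hind.span_eq_top_of_card_eq_finrank (by simp)
  rw [Matrix.range_cons, Matrix.range_cons, Matrix.range_empty, Set.union_empty,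
    Set.singleton_union] at hspan
  obtain ⟨a, b, hab⟩ := Submodule.mem_span_pair.1 (hspan ▸ Submodule.mem_top (x := w))
  have hw_eq : w = round a • w₁ + round b • w₂ := by
    rw [← sub_eq_zero]
    by_contra hne
    refine (hr _ (Λ.sub_mem hw (Λ.add_mem (Λ.zsmul_mem hw₁ _) (Λ.zsmul_mem hw₂ _))) hne).not_gt ?_
    have hsub : w - (round a • w₁ + round b • w₂) = (a - round a) • w₁ + (b - round b) • w₂ := by
      rw [← hab, ← Int.cast_smul_eq_zsmul ℝ, ← Int.cast_smul_eq_zsmul ℝ]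
      module
    rw [hsub]
    exact norm_smul_add_smul_lt_of_abs_le_half hind hn₁ hn₂ (abs_sub_round a) (abs_sub_round b)
  refine ⟨(round a, round b), hw_eq, fun p hp => ?_⟩
  rw [hw_eq, ← Int.cast_smul_eq_zsmul ℝ, ← Int.cast_smul_eq_zsmul ℝ,
    ← Int.cast_smul_eq_zsmul ℝ p.1, ← Int.cast_smul_eq_zsmul ℝ p.2] at hp
  obtain ⟨h₁, h₂⟩ := hind.eq_of_pair hp
  exact Prod.ext (Int.cast_injective h₁).symm (Int.cast_injective h₂).symm
end

section
/- Let R ≤ Aff(T²) be a subgroup containing S¹ with finite index. Then one of the following holds: (1) there is an integer n ≥ 1 with R = ⟨S¹ ∪ {τ_{(0,1/n)}}⟩; (2) there are an integer n ≥ 1 and t₁ ∈ ℝ with R = ⟨S¹ ∪ {τ_{(0,1/n)}, σ}⟩, where σ is the affine transformation σ(π(x)) = π(−x + (0, t₁)); (3) there are a subgroup K ≤ Aff(T²) of the form (1) or (2), an integer a, t₂ ∈ ℝ, and ε ∈ {1, −1} such that, with g the affine transformation g(π(x)) = π(ε·M(a)·x + (0, t₂)), one has g² ∈ K and R = ⟨K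 ∪ {g}⟩. -/
noncomputable section

/-- The integer lattice `ℤ²` inside `ℝ²` (vectors all of whose coordinates are integers). -/
def intLattice : AddSubgroup (Fin 2 → ℝ) where
  carrier := {v | ∀ i, ∃ n : ℤ, (n : ℝ) = v i}
  zero_mem' := fun i => ⟨0, by simp⟩
  add_mem' := by
    rintro a b ha hb i
    obtain ⟨n, hn⟩ := ha i
    obtain ⟨k, hk⟩ := hb i
    exact ⟨n + k, by push_cast [hn, hk]; simp⟩
  neg_mem' := by
    rintro a ha i
    obtain ⟨n, hn⟩ := ha i
    exact ⟨-n, by push_cast [hn]; simp⟩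

/-- The two-torus `T² = ℝ²/ℤ²`. -/
abbrev Torus2 : Type := (Fin 2 → ℝ) ⧸ intLattice

/-- The quotient map `π : ℝ² → T²`. -/
def torusMk : (Fin 2 → ℝ) →+ Torus2 := QuotientAddGroup.mk' intLattice

/-- The translation `τ_w : T² ≃ T²`, `π x ↦ π (x + w)`. -/
def tr (w : Fin 2 → ℝ) : Equiv.Perm Torus2 := Equiv.addLeft (torusMk w)

/-- The rotation circle `S¹ = {τ_{(t,0)} : t ∈ ℝ}` as a set of permutations of `T²`. -/
def circleSet : Set (Equiv.Perm Torus2) := Set.range fun t : ℝ => tr ![t, 0]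

/-- A permutation of `T²` is an affine transformation: it is induced by `x ↦ A·x + c`
for some `A ∈ GL₂(ℤ)` and `c ∈ ℝ²`. -/
def IsAffinePerm (f : Equiv.Perm Torus2) : Prop :=
  ∃ (A : Matrix (Fin 2) (Fin 2) ℤ) (c : Fin 2 → ℝ), IsUnit A.det ∧
    ∀ x : Fin 2 → ℝ, f (torusMk x) = torusMk ((A.map (Int.cast : ℤ → ℝ)).mulVec x + c)

/-- `R` contains `S¹` with finite index: `S¹ ⊆ R` and `R` is a finite union of
left cosets of `S¹`. -/
def ContainsCircleFinIndex (R : Subgroup (Equiv.Perm Torus2)) : Prop :=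
  circleSet ⊆ (R : Set (Equiv.Perm Torus2)) ∧
    ∃ s : Finset (Equiv.Perm Torus2), (↑s : Set (Equiv.Perm Torus2)) ⊆ (R : Set (Equiv.Perm Torus2)) ∧
      ∀ f ∈ R, ∃ g ∈ s, ∃ t : ℝ, f = g * tr ![t, 0]

/-- For `a : ℤ`, the matrix `M(a) = [[1, a], [0, -1]]`. -/
def Mmat (a : ℤ) : Matrix (Fin 2) (Fin 2) ℤ := !![1, a; 0, -1]

/-- Form (1): `R = ⟨S¹ ∪ {τ_{(0,1/n)}}⟩` for some `n ≥ 1`. -/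
def Form1 (R : Subgroup (Equiv.Perm Torus2)) : Prop :=
  ∃ n : ℕ, 1 ≤ n ∧ R = Subgroup.closure (circleSet ∪ {tr ![0, (n : ℝ)⁻¹]})

/-- Form (2): `R = ⟨S¹ ∪ {τ_{(0,1/n)}, σ}⟩` where `σ(π x) = π(-x + (0, t₁))`. -/
def Form2 (R : Subgroup (Equiv.Perm Torus2)) : Prop :=
  ∃ n : ℕ, 1 ≤ n ∧ ∃ t₁ : ℝ,
    R = Subgroup.closure (circleSet ∪
      {tr ![0, (n : ℝ)⁻¹], (Equiv.neg Torus2).trans (Equiv.addLeft (torusMk ![0, t₁]))})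

/-- Form (3): `R = ⟨K ∪ {g}⟩` where `K` is of form (1) or (2),
`g(π x) = π(ε·M(a)·x + (0,t₂))` with `ε = ±1`, and `g² ∈ K`. -/
def Form3 (R : Subgroup (Equiv.Perm Torus2)) : Prop :=
  ∃ K : Subgroup (Equiv.Perm Torus2), (Form1 K ∨ Form2 K) ∧
    ∃ (a : ℤ) (t₂ : ℝ) (ε : ℝ), (ε = 1 ∨ ε = -1) ∧
      ∃ g : Equiv.Perm Torus2,
        (∀ x : Fin 2 → ℝ,
          g (torusMk x) = torusMk (ε • ((Mmat a).map (Int.cast : ℤ → ℝ)).mulVec x + ![0, t₂])) ∧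
        g ^ 2 ∈ K ∧ R = Subgroup.closure ((K : Set (Equiv.Perm Torus2)) ∪ {g})

/-- `f` is the affine transformation of the torus induced by `x ↦ A·x + c`. -/
def InducedBy (f : Equiv.Perm Torus2) (A : Matrix (Fin 2) (Fin 2) ℤ) (c : Fin 2 → ℝ) : Prop :=
  ∀ x : Fin 2 → ℝ, f (torusMk x) = torusMk ((A.map (Int.cast : ℤ → ℝ)).mulVec x + c)

theorem torusMk_surjective : Function.Surjective torusMk :=
  QuotientAddGroup.mk'_surjective intLattice

theorem torusMk_eq_iff (v w : Fin 2 → ℝ) :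
    torusMk v = torusMk w ↔ ∀ i, ∃ n : ℤ, (n : ℝ) = w i - v i := by
  have h : torusMk v = torusMk w ↔ -v + w ∈ intLattice :=
    QuotientAddGroup.eq (s := intLattice)
  rw [h]
  change (∀ i, ∃ n : ℤ, (n : ℝ) = (-v + w) i) ↔ _
  simp only [Pi.add_apply, Pi.neg_apply, neg_add_eq_sub]

theorem perm_ext {f g : Equiv.Perm Torus2} (h : ∀ x, f (torusMk x) = g (torusMk x)) : f = g := by
  ext y
  obtain ⟨x, rfl⟩ := torusMk_surjective y
  exact h x

theorem tr_apply (w x : Fin 2 → ℝ) : tr w (torusMk x) = torusMk (w + x) := by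
  simp [tr]

theorem tr_add (v w : Fin 2 → ℝ) : tr (v + w) = tr v * tr w := by
  refine perm_ext fun x => ?_
  rw [Equiv.Perm.mul_apply, tr_apply, tr_apply, tr_apply, add_assoc]

theorem tr_zero : tr 0 = 1 := by
  refine perm_ext fun x => ?_
  simp [tr_apply]

theorem tr_neg (v : Fin 2 → ℝ) : tr (-v) = (tr v)⁻¹ := by
  rw [eq_inv_iff_mul_eq_one, ← tr_add, neg_add_cancel, tr_zero]

theorem tr_nsmul (m : ℕ) (v : Fin 2 → ℝ) : tr (m • v) = tr v ^ m := by
  induction m with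
  | zero => simp [tr_zero]
  | succ k ih => rw [succ_nsmul, tr_add, ih, pow_succ]

theorem tr_zsmul (m : ℤ) (v : Fin 2 → ℝ) : tr (m • v) = tr v ^ m := by
  cases m with
  | ofNat k => simpa using tr_nsmul k v
  | negSucc k => rw [negSucc_zsmul, tr_neg, tr_nsmul, zpow_negSucc]

theorem tr_eq_mul (w : Fin 2 → ℝ) : tr w = tr ![w 0, 0] * tr ![0, w 1] := by
  rw [← tr_add]
  congr 1
  ext i
  fin_cases i <;> simp

theorem exists_int_of_tr_eq {v w : Fin 2 → ℝ} (h : tr v = tr w) (i : Fin 2) :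
    ∃ n : ℤ, (n : ℝ) = w i - v i := by
  have h0 := DFunLike.congr_fun h (torusMk 0)
  rw [tr_apply, tr_apply, add_zero, add_zero] at h0
  exact (torusMk_eq_iff v w).1 h0 i

theorem tr_int_eq_one (n : ℤ) : tr ![0, (n : ℝ)] = 1 := by
  refine perm_ext fun x => ?_
  rw [tr_apply, Equiv.Perm.one_apply, torusMk_eq_iff]
  intro i
  fin_cases i
  · exact ⟨0, by simp⟩
  · exact ⟨-n, by simp⟩

theorem int_eq_zero_of_mul_sqrt_two {k n : ℤ} (h : (n : ℝ) = k * √2) : k = 0 := by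
  by_contra hk
  exact (irrational_sqrt_two.intCast_mul hk).ne_int n h.symm

namespace InducedBy

variable {f g : Equiv.Perm Torus2} {A B : Matrix (Fin 2) (Fin 2) ℤ} {c d : Fin 2 → ℝ}

theorem tr (w : Fin 2 → ℝ) : InducedBy (tr w) 1 w := by
  intro x
  rw [tr_apply, Matrix.map_one _ Int.cast_zero Int.cast_one, Matrix.one_mulVec, add_comm]

theorem eq_tr (h : InducedBy f 1 c) : f = _root_.tr c :=
  perm_ext fun x => (h x).trans (InducedBy.tr c x).symm

theorem one : InducedBy 1 1 0 := tr_zero ▸ InducedBy.tr 0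

theorem mul (hf : InducedBy f A c) (hg : InducedBy g B d) :
    InducedBy (f * g) (A * B) ((A.map (Int.cast : ℤ → ℝ)).mulVec d + c) := by
  intro x
  have h : (A * B).map (Int.cast : ℤ → ℝ) = A.map Int.cast * B.map Int.cast :=
    Matrix.map_mul (f := Int.castRingHom ℝ)
  rw [Equiv.Perm.mul_apply, hg, hf, h, ← Matrix.mulVec_mulVec, Matrix.mulVec_add, add_assoc]

theorem inv (hf : InducedBy f A c) (hBA : A * B = 1) :
    InducedBy f⁻¹ B (-(B.map (Int.cast : ℤ → ℝ)).mulVec c) := by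
  intro x
  have h : A.map (Int.cast : ℤ → ℝ) * B.map (Int.cast : ℤ → ℝ) = 1 := by
    have h := Matrix.map_mul (f := Int.castRingHom ℝ) (L := A) (M := B)
    rw [hBA] at h
    simpa using h.symm
  rw [Equiv.Perm.inv_eq_iff_eq, hf, Matrix.mulVec_add, Matrix.mulVec_neg, Matrix.mulVec_mulVec,
    Matrix.mulVec_mulVec, h]
  simp

theorem pow (hf : InducedBy f A c) (m : ℕ) : ∃ d, InducedBy (f ^ m) (A ^ m) d := by
  induction m with
  | zero => exact ⟨0, by simpa using one⟩
  | succ k ih =>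
    obtain ⟨d, hd⟩ := ih
    exact ⟨_, by simpa only [pow_succ] using hd.mul hf⟩

theorem matrix_unique (hA : InducedBy f A c) (hB : InducedBy f B d) : A = B := by
  have key : ∀ x i, ∃ n : ℤ, (n : ℝ) =
      ((B.map (Int.cast : ℤ → ℝ)).mulVec x + d) i - ((A.map (Int.cast : ℤ → ℝ)).mulVec x + c) i :=
    fun x i => (torusMk_eq_iff _ _).1 ((hA x).symm.trans (hB x)) i
  ext i j
  obtain ⟨n, hn⟩ := key (Pi.single j √2) i
  obtain ⟨k, hk⟩ := key 0 i
  simp only [Pi.add_apply, Matrix.mulVec_single, Matrix.mulVec_zero, Pi.zero_apply, zero_add,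
    Pi.smul_apply, Matrix.col_apply, Matrix.map_apply, MulOpposite.smul_eq_mul_unop,
    MulOpposite.unop_op] at hn hk
  have h : ((n - k : ℤ) : ℝ) = ((B i j - A i j : ℤ) : ℝ) * √2 := by
    push_cast
    rw [hn, hk]
    ring
  have := int_eq_zero_of_mul_sqrt_two h
  omega

theorem mul_tr (hf : InducedBy f A c) (w : Fin 2 → ℝ) :
    f * _root_.tr w * f⁻¹ = _root_.tr ((A.map (Int.cast : ℤ → ℝ)).mulVec w) := by
  rw [mul_inv_eq_iff_eq_mul]
  refine perm_ext fun x => ?_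
  rw [Equiv.Perm.mul_apply, Equiv.Perm.mul_apply, tr_apply, hf, hf, tr_apply, Matrix.mulVec_add,
    add_assoc]

end InducedBy

theorem ContainsCircleFinIndex.exists_pow_eq {R : Subgroup (Equiv.Perm Torus2)}
    (hR : ContainsCircleFinIndex R) :
    ∃ N : ℕ, ∀ f ∈ R, ∃ m, 0 < m ∧ m ≤ N ∧ ∃ t : ℝ, f ^ m = tr ![t, 0] := by
  obtain ⟨-, s, -, hs⟩ := hR
  refine ⟨s.card, fun f hf => ?_⟩
  choose g hg t ht using fun i : ℕ => hs (f ^ i) (R.pow_mem hf i)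
  obtain ⟨i, hi, j, hj, hij, hgij⟩ : ∃ i ∈ Finset.range (s.card + 1),
      ∃ j ∈ Finset.range (s.card + 1), i < j ∧ g i = g j := by
    obtain ⟨i, hi, j, hj, hne, h⟩ := Finset.exists_ne_map_eq_of_card_lt_of_maps_to
      (s := Finset.range (s.card + 1)) (t := s) (by simp) (f := g) (fun i _ => hg i)
    rcases lt_or_gt_of_ne hne with hlt | hlt
    · exact ⟨i, hi, j, hj, hlt, h⟩
    · exact ⟨j, hj, i, hi, hlt, h.symm⟩
  rw [Finset.mem_range] at hi hj
  refine ⟨j - i, by omega, by omega, t j - t i, ?_⟩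
  have h1 : f ^ (j - i) = (f ^ i)⁻¹ * f ^ j := by
    rw [eq_inv_mul_iff_mul_eq, ← pow_add]
    congr 1
    omega
  rw [h1, ht i, ht j, hgij, mul_inv_rev, mul_assoc, inv_mul_cancel_left, ← tr_neg, ← tr_add]
  congr 1
  ext l
  fin_cases l <;> simp [neg_add_eq_sub]

section LinearPart

variable {R : Subgroup (Equiv.Perm Torus2)} {f : Equiv.Perm Torus2}
  {A : Matrix (Fin 2) (Fin 2) ℤ} {c : Fin 2 → ℝ}

theorem InducedBy.lower_left_eq_zero (hR : ContainsCircleFinIndex R) (hf : f ∈ R)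
    (h : InducedBy f A c) : A 1 0 = 0 := by
  obtain ⟨N, hN⟩ := hR.exists_pow_eq
  have hmem := R.mul_mem (R.mul_mem hf (hR.1 ⟨√2, rfl⟩)) (R.inv_mem hf)
  beta_reduce at hmem
  rw [h.mul_tr] at hmem
  obtain ⟨m, hm, -, t, ht⟩ := hN _ hmem
  rw [← tr_nsmul] at ht
  obtain ⟨n, hn⟩ := exists_int_of_tr_eq ht 1
  have h2 : (n : ℝ) = ((-(m * A 1 0) : ℤ) : ℝ) * √2 := by
    rw [hn]
    simp
    ring
  have := int_eq_zero_of_mul_sqrt_two h2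
  rw [neg_eq_zero, mul_eq_zero] at this
  exact this.resolve_left (by exact_mod_cast hm.ne')

theorem upper_unitriangular_pow (k : ℤ) (m : ℕ) :
    (!![1, k; 0, 1] : Matrix (Fin 2) (Fin 2) ℤ) ^ m = !![1, m * k; 0, 1] := by
  induction m with
  | zero => simp [Matrix.one_fin_two]
  | succ n ih =>
    rw [pow_succ, ih, Matrix.mul_fin_two]
    simp
    ring

theorem InducedBy.eq_one_or_eq_neg_one (hR : ContainsCircleFinIndex R) (hf : f ∈ R)
    (h : InducedBy f A c) (hdet : A.det = 1) : A = 1 ∨ A = -1 := by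
  have h0 := h.lower_left_eq_zero hR hf
  rw [Matrix.det_fin_two, h0, mul_zero, sub_zero] at hdet
  obtain ⟨N, hN⟩ := hR.exists_pow_eq
  obtain ⟨m, hm, -, t, ht⟩ := hN _ (R.mul_mem hf hf)
  obtain ⟨d, hd⟩ := (h.mul h).pow m
  rw [ht] at hd
  have hpow := hd.matrix_unique (InducedBy.tr _)
  rw [Matrix.eta_fin_two A, h0] at hpow ⊢
  rcases Int.eq_one_or_neg_one_of_mul_eq_one' hdet with ⟨h1, h2⟩ | ⟨h1, h2⟩
  · rw [h1, h2, Matrix.mul_fin_two] at hpow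
    norm_num at hpow
    rw [upper_unitriangular_pow, Matrix.one_fin_two] at hpow
    have h3 := congrFun (congrFun hpow 0) 1
    simp [hm.ne'] at h3
    left
    have h4 : A 0 1 = 0 := by omega
    rw [h1, h2, h4, Matrix.one_fin_two]
  · rw [h1, h2, Matrix.mul_fin_two] at hpow
    norm_num at hpow
    rw [upper_unitriangular_pow, Matrix.one_fin_two] at hpow
    have h3 := congrFun (congrFun hpow 0) 1
    simp [hm.ne'] at h3
    right
    have h4 : A 0 1 = 0 := by omega
    rw [h1, h2, h4]
    simp [Matrix.one_fin_two]

end LinearPart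

theorem exists_translations_eq {R : Subgroup (Equiv.Perm Torus2)}
    (hR : ContainsCircleFinIndex R) :
    ∃ n : ℕ, 1 ≤ n ∧ tr ![0, (n : ℝ)⁻¹] ∈ R ∧
      ∀ u : ℝ, tr ![0, u] ∈ R → ∃ k : ℤ, u = k * (n : ℝ)⁻¹ := by
  obtain ⟨N, hN⟩ := hR.exists_pow_eq
  let H : AddSubgroup ℝ :=
    { carrier := {u | tr ![0, u] ∈ R}
      zero_mem' := by
        have := tr_int_eq_one 0
        rw [Int.cast_zero] at this
        change tr ![0, 0] ∈ R
        rw [this]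
        exact R.one_mem
      add_mem' := fun {a b} ha hb => by
        have : (![0, a + b] : Fin 2 → ℝ) = ![0, a] + ![0, b] := by simp
        change tr ![0, a + b] ∈ R
        rw [this, tr_add]
        exact R.mul_mem ha hb
      neg_mem' := fun {a} ha => by
        have : (![0, -a] : Fin 2 → ℝ) = -![0, a] := by simp
        change tr ![0, -a] ∈ R
        rw [this, tr_neg]
        exact R.inv_mem ha }
  have hone : (1 : ℝ) ∈ H := by
    change tr ![0, 1] ∈ R
    have := tr_int_eq_one 1
    rw [Int.cast_one] at this
    rw [this]
    exact R.one_mem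
  have hmul : ∀ u ∈ H, ∃ m : ℕ, 0 < m ∧ m ≤ N ∧ ∃ k : ℤ, (k : ℝ) = m * u := by
    intro u hu
    obtain ⟨m, hm, hmN, t, ht⟩ := hN _ hu
    rw [← tr_nsmul] at ht
    obtain ⟨k, hk⟩ := exists_int_of_tr_eq ht 1
    refine ⟨m, hm, hmN, -k, ?_⟩
    push_cast
    rw [hk]
    simp
  rcases H.dense_or_cyclic with hd | ⟨a, ha⟩
  · exfalso
    obtain ⟨u, hu, hu0, hu1⟩ := hd.exists_between (show (0 : ℝ) < 1 / (N + 1) by positivity)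
    obtain ⟨m, hm, hmN, k, hk⟩ := hmul u hu
    have hm' : (0 : ℝ) < m := by exact_mod_cast hm
    have hmN' : (m : ℝ) ≤ N := by exact_mod_cast hmN
    have hk0 : (0 : ℝ) < k := by rw [hk]; positivity
    have hk1 : (k : ℝ) < 1 := by
      rw [hk]
      rw [lt_div_iff₀ (by positivity)] at hu1
      nlinarith
    norm_cast at hk0 hk1
    omega
  · have hmem : ∀ u, u ∈ H ↔ ∃ k : ℤ, k * a = u := by
      intro u
      rw [ha, AddSubgroup.mem_closure_singleton]
      simp
    obtain ⟨k, hk⟩ := (hmem 1).1 hone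
    have hk0 : k ≠ 0 := by
      rintro rfl
      simp at hk
    have hkR : (k : ℝ) ≠ 0 := by exact_mod_cast hk0
    have hak : a = (k : ℝ)⁻¹ := eq_inv_of_mul_eq_one_right hk
    have hcast : ((k.natAbs : ℕ) : ℝ) = |(k : ℝ)| := by
      rw [Nat.cast_natAbs, Int.cast_abs]
    refine ⟨k.natAbs, Int.natAbs_pos.2 hk0, ?_, fun u hu => ?_⟩
    · refine (hmem _).2 ?_
      rw [hcast, hak]
      rcases abs_choice (k : ℝ) with h | h
      · exact ⟨1, by rw [h]; simp⟩
      · exact ⟨-1, by rw [h]; simp [inv_neg]⟩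
    · obtain ⟨l, hl⟩ := (hmem u).1 hu
      rw [hcast, ← hl, hak]
      rcases abs_choice (k : ℝ) with h | h
      · exact ⟨l, by rw [h]⟩
      · exact ⟨-l, by rw [h]; simp [inv_neg]⟩

theorem inducedBy_neg_trans (t : ℝ) :
    InducedBy ((Equiv.neg Torus2).trans (Equiv.addLeft (torusMk ![0, t]))) (-1) ![0, t] := by
  intro x
  have h : (-1 : Matrix (Fin 2) (Fin 2) ℤ).map (Int.cast : ℤ → ℝ) = -1 := by
    ext i j
    fin_cases i <;> fin_cases j <;> simp
  rw [h, Matrix.neg_mulVec, Matrix.one_mulVec, add_comm, map_add, map_neg]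
  rfl

/-- A group of translations and point reflections that contains the circle with finite index
is of form (1) or (2). -/
theorem form1_or_form2 {K : Subgroup (Equiv.Perm Torus2)} (hK : ContainsCircleFinIndex K)
    (h : ∀ f ∈ K, ∃ A c, InducedBy f A c ∧ (A = 1 ∨ A = -1)) : Form1 K ∨ Form2 K := by
  obtain ⟨n, hn, hnK, hall⟩ := exists_translations_eq hK
  have htr : ∀ L : Subgroup (Equiv.Perm Torus2), circleSet ⊆ L → tr ![0, (n : ℝ)⁻¹] ∈ L →
      ∀ w, tr w ∈ K → tr w ∈ L := by
    intro L hL hnL w hw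
    rw [tr_eq_mul] at hw ⊢
    refine L.mul_mem (hL ⟨w 0, rfl⟩) ?_
    obtain ⟨k, hk⟩ := hall _ ((K.mul_mem_cancel_left (hK.1 ⟨w 0, rfl⟩)).1 hw)
    have : (![0, w 1] : Fin 2 → ℝ) = k • ![0, (n : ℝ)⁻¹] := by simp [hk]
    rw [this, tr_zsmul]
    exact L.zpow_mem hnL k
  by_cases hneg : ∃ f ∈ K, ∃ c, InducedBy f (-1) c
  · right
    obtain ⟨f, hf, c, hfc⟩ := hneg
    have hσ : (Equiv.neg Torus2).trans (Equiv.addLeft (torusMk ![0, c 1])) ∈ K := by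
      have heq : (Equiv.neg Torus2).trans (Equiv.addLeft (torusMk ![0, c 1])) =
          tr ![-c 0, 0] * f := by
        refine perm_ext fun x => ?_
        rw [inducedBy_neg_trans, Equiv.Perm.mul_apply, hfc, tr_apply, add_left_comm]
        congr 2
        ext i
        fin_cases i <;> simp
      rw [heq]
      exact K.mul_mem (hK.1 ⟨-c 0, rfl⟩) hf
    refine ⟨n, hn, c 1, le_antisymm (fun g hg => ?_) ?_⟩
    · set σ := (Equiv.neg Torus2).trans (Equiv.addLeft (torusMk ![0, c 1]))
      set L := Subgroup.closure (circleSet ∪ {tr ![0, (n : ℝ)⁻¹], σ})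
      have hcL : circleSet ⊆ L := Set.subset_union_left.trans Subgroup.subset_closure
      have hnL : tr ![0, (n : ℝ)⁻¹] ∈ L := Subgroup.subset_closure (by simp)
      have hσL : σ ∈ L := Subgroup.subset_closure (by simp)
      obtain ⟨A, d, hA, rfl | rfl⟩ := h g hg
      · rw [hA.eq_tr] at hg ⊢
        exact htr L hcL hnL d hg
      · have hgσ := hA.mul (inducedBy_neg_trans (c 1))
        rw [neg_mul_neg, one_mul] at hgσ
        have hmem := K.mul_mem hg hσ
        rw [hgσ.eq_tr] at hmem
        have hmemL := htr L hcL hnL _ hmem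
        rw [← hgσ.eq_tr] at hmemL
        exact (L.mul_mem_cancel_right hσL).1 hmemL
    · rw [Subgroup.closure_le]
      rintro g (hg | rfl | rfl)
      · exact hK.1 hg
      · exact hnK
      · exact hσ
  · left
    refine ⟨n, hn, le_antisymm (fun g hg => ?_) ?_⟩
    · obtain ⟨A, d, hA, rfl | rfl⟩ := h g hg
      · rw [hA.eq_tr] at hg ⊢
        exact htr _ (Set.subset_union_left.trans Subgroup.subset_closure)
          (Subgroup.subset_closure (by simp)) d hg
      · exact absurd ⟨g, hg, d, hA⟩ hneg
    · rw [Subgroup.closure_le]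
      rintro g (hg | rfl)
      · exact hK.1 hg
      · exact hnK

theorem ContainsCircleFinIndex.of_le {K R : Subgroup (Equiv.Perm Torus2)}
    (hR : ContainsCircleFinIndex R) (hKR : K ≤ R) (hK : circleSet ⊆ K) :
    ContainsCircleFinIndex K := by
  classical
  obtain ⟨-, s, -, hs⟩ := hR
  refine ⟨hK, s.filter (· ∈ K), fun g hg => (Finset.mem_filter.1 hg).2, fun f hf => ?_⟩
  obtain ⟨g, hg, t, rfl⟩ := hs f (hKR hf)
  exact ⟨g, Finset.mem_filter.2 ⟨hg, (K.mul_mem_cancel_right (hK ⟨t, rfl⟩)).1 hf⟩, t, rfl⟩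

/-- The elements of `R` with a linear part of determinant `1`. -/
def orientationPreserving (R : Subgroup (Equiv.Perm Torus2)) : Subgroup (Equiv.Perm Torus2) where
  carrier := {f | f ∈ R ∧ ∃ A c, InducedBy f A c ∧ A.det = 1}
  one_mem' := ⟨R.one_mem, 1, 0, InducedBy.one, Matrix.det_one⟩
  mul_mem' := by
    rintro f g ⟨hf, A, c, hA, hAd⟩ ⟨hg, B, d, hB, hBd⟩
    exact ⟨R.mul_mem hf hg, _, _, hA.mul hB, by rw [Matrix.det_mul, hAd, hBd, one_mul]⟩
  inv_mem' := by
    rintro f ⟨hf, A, c, hA, hAd⟩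
    refine ⟨R.inv_mem hf, A.adjugate, _, hA.inv ?_, ?_⟩
    · rw [Matrix.mul_adjugate, hAd, one_smul]
    · rw [Matrix.det_adjugate, hAd, one_pow]

theorem exists_eq_smul_Mmat {A : Matrix (Fin 2) (Fin 2) ℤ} (h0 : A 1 0 = 0) (hdet : A.det = -1) :
    ∃ (a : ℤ) (ε : ℝ), (ε = 1 ∨ ε = -1) ∧
      A.map (Int.cast : ℤ → ℝ) = ε • (Mmat a).map (Int.cast : ℤ → ℝ) := by
  rw [Matrix.det_fin_two, h0, mul_zero, sub_zero] at hdet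
  rcases Int.mul_eq_neg_one_iff_eq_one_or_neg_one.1 hdet with ⟨h1, h2⟩ | ⟨h1, h2⟩
  · refine ⟨A 0 1, 1, Or.inl rfl, ?_⟩
    ext i j
    fin_cases i <;> fin_cases j <;> simp [Mmat, h0, h1, h2]
  · refine ⟨-A 0 1, -1, Or.inr rfl, ?_⟩
    ext i j
    fin_cases i <;> fin_cases j <;> simp [Mmat, h0, h1, h2]

/-- Every subgroup of `Aff(T²)` containing the rotation circle `S¹` with
finite index is of one of the three forms (1)–(3). -/
theorem stmt_3 (R : Subgroup (Equiv.Perm Torus2))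
    (haff : ∀ f ∈ R, IsAffinePerm f)
    (hR : ContainsCircleFinIndex R) :
    Form1 R ∨ Form2 R ∨ Form3 R := by
  set K := orientationPreserving R
  have hKR : K ≤ R := fun f hf => hf.1
  have hcK : circleSet ⊆ K := by
    rintro _ ⟨t, rfl⟩
    exact ⟨hR.1 ⟨t, rfl⟩, 1, _, InducedBy.tr _, Matrix.det_one⟩
  have hK : Form1 K ∨ Form2 K := by
    refine form1_or_form2 (hR.of_le hKR hcK) fun f hf => ?_
    obtain ⟨hfR, A, c, hA, hdet⟩ := hf
    exact ⟨A, c, hA, hA.eq_one_or_eq_neg_one hR hfR hdet⟩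
  by_cases hRK : R ≤ K
  · rw [le_antisymm hRK hKR, ← or_assoc]
    exact Or.inl hK
  right; right
  have hdet : ∀ f ∈ R, f ∉ K → ∃ A c, InducedBy f A c ∧ A.det = -1 := by
    intro f hf hfK
    obtain ⟨A, c, hu, hA⟩ := haff f hf
    refine ⟨A, c, hA, (Int.isUnit_iff.1 hu).resolve_left fun h => hfK ⟨hf, A, c, hA, h⟩⟩
  have hprod : ∀ f ∈ R, f ∉ K → ∀ g ∈ R, g ∉ K → f * g ∈ K := by
    intro f hf hfK g hg hgK
    obtain ⟨A, c, hA, hAd⟩ := hdet f hf hfK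
    obtain ⟨B, d, hB, hBd⟩ := hdet g hg hgK
    exact ⟨R.mul_mem hf hg, _, _, hA.mul hB, by rw [Matrix.det_mul, hAd, hBd]; norm_num⟩
  obtain ⟨f, hf, hfK⟩ := SetLike.not_le_iff_exists.1 hRK
  obtain ⟨A, c, hA, hAd⟩ := hdet f hf hfK
  obtain ⟨a, ε, hε, hAε⟩ := exists_eq_smul_Mmat (hA.lower_left_eq_zero hR hf) hAd
  have hcirc : tr ![-c 0, 0] ∈ K := hcK ⟨-c 0, rfl⟩
  have hgR : tr ![-c 0, 0] * f ∈ R := R.mul_mem (hKR hcirc) hf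
  have hgK : tr ![-c 0, 0] * f ∉ K := fun h => hfK ((K.mul_mem_cancel_left hcirc).1 h)
  refine ⟨K, hK, a, c 1, ε, hε, tr ![-c 0, 0] * f, fun x => ?_, ?_, le_antisymm ?_ ?_⟩
  · rw [Equiv.Perm.mul_apply, hA, tr_apply, hAε, Matrix.smul_mulVec, add_left_comm]
    congr 2
    ext i
    fin_cases i <;> simp
  · rw [pow_two]
    exact hprod _ hgR hgK _ hgR hgK
  · intro h hh
    set L := Subgroup.closure ((K : Set (Equiv.Perm Torus2)) ∪ {tr ![-c 0, 0] * f})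
    have hKL : K ≤ L := fun k hk => Subgroup.subset_closure (Or.inl hk)
    by_cases hhK : h ∈ K
    · exact hKL hhK
    · have hgL : tr ![-c 0, 0] * f ∈ L := Subgroup.subset_closure (Or.inr rfl)
      exact (L.mul_mem_cancel_right hgL).1 (hKL (hprod _ hh hhK _ hgR hgK))
  · rw [Subgroup.closure_le]
    rintro h (hh | rfl)
    · exact hKR hh
    · exact hgR
end
end

section
/- A pointwise preclutching map ψ is an equivariant pointwise clutching map — i.e. satisfies conditions (1) and (2) — if and only if the subspace U_ψ is ρ-invariant (ρ(g)(U_ψ) = U_ψ for all g ∈ N₂) and the map ι_ψ : W 0 → V ⧸ U_ψ is bijective. (In the paper's language: the quotient F/ψ carries an N₂-representation structure making the quotient map p_ψ equivariant and ι_ψ an N₁-isomorphism if and only if (1) and (2) hold.) -/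
noncomputable section

namespace EqClutch

variable {m : ℕ}

/-- The iterate `Ψ_j^k = ψ_{j+k-1} ∘ ⋯ ∘ ψ_{j+1} ∘ ψ_j : W j ≃ W (j+k)` of a pointwise
preclutching map `ψ`. -/
def Psi {V : Type*} [AddCommGroup V] [Module ℂ V] (W : ZMod m → Submodule ℂ V)
    (ψ : ∀ j : ZMod m, W j ≃ₗ[ℂ] W (j + 1)) :
    ∀ (j : ZMod m) (k : ℕ), W j ≃ₗ[ℂ] W (j + (k : ZMod m))
  | j, 0 => LinearEquiv.ofEq _ _ (by norm_num)
  | j, (k + 1) =>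
      ((Psi W ψ j k).trans (ψ (j + (k : ZMod m)))).trans
        (LinearEquiv.ofEq _ _ (by rw [Nat.cast_add, Nat.cast_one, add_assoc]))

/-- `g` lies in the kernel `N₀` of the action of `N₂` on `ZMod m`. -/
def InKernel (N₂ : Type*) [Group N₂] [MulAction N₂ (ZMod m)] (g : N₂) : Prop :=
  ∀ j : ZMod m, g • j = j

/-- `B : p ≃ q` commutes with `ρ g` (equivariance, stated via the ambient space `V`). -/
def IsEquivariantOn {N₂ : Type*} [Group N₂] {V : Type*} [AddCommGroup V] [Module ℂ V]
    (ρ : N₂ →* (V ≃ₗ[ℂ] V)) {p q : Submodule ℂ V} (B : p ≃ₗ[ℂ] q) (g : N₂) : Prop :=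
  ∀ (w w' : p), (w' : V) = ρ g (w : V) → ((B w' : V) = ρ g ((B w : V)))

/-- A pointwise preclutching map `ψ` is an *equivariant pointwise clutching map*:
(1) `Ψ_j^m = id` for every `j`; (2) for every `j₁` and `g ∈ N₂`, with `j₂ = g⁻¹ • j₁`,
`j₃ = g • (j₂ + 1)` and `k ∈ {0, …, m-1}` the representative of `j₃ - j₁`, one has
`Ψ_{j₁}^k = ρ(g) ∘ ψ_{j₂} ∘ ρ(g)⁻¹` as maps `W j₁ → W j₃`. -/
def IsClutch {N₂ : Type*} [Group N₂] [MulAction N₂ (ZMod m)]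
    {V : Type*} [AddCommGroup V] [Module ℂ V]
    (ρ : N₂ →* (V ≃ₗ[ℂ] V)) (W : ZMod m → Submodule ℂ V)
    (ψ : ∀ j : ZMod m, W j ≃ₗ[ℂ] W (j + 1)) : Prop :=
  (∀ (j : ZMod m) (w : W j), ((Psi W ψ j m) w : V) = (w : V)) ∧
  (∀ (j₁ : ZMod m) (g : N₂) (w₁ : W j₁) (w₂ : W (g⁻¹ • j₁)),
      (w₂ : V) = ρ g⁻¹ (w₁ : V) →
      ((Psi W ψ j₁ ((g • (g⁻¹ • j₁ + 1) - j₁).val)) w₁ : V) =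
        ρ g (((ψ (g⁻¹ • j₁)) w₂ : V)))

section Aux

variable {V : Type*} [AddCommGroup V] [Module ℂ V] {W : ZMod m → Submodule ℂ V}

/-- A family of maps `W j → W (j + 1)` on the summands of an internal direct sum is induced by a
single endomorphism of the ambient space. -/
theorem exists_endomorphism_extending (hIndep : iSupIndep W) (hSpan : (⨆ j, W j) = ⊤)
    (ψ : ∀ j : ZMod m, W j ≃ₗ[ℂ] W (j + 1)) :
    ∃ P : Module.End ℂ V, ∀ (j : ZMod m) (w : W j), P w = ψ j w := by
  have h := DirectSum.isInternal_submodule_of_iSupIndep_of_iSup_eq_top hIndep hSpan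
  let e := LinearEquiv.ofBijective (DirectSum.coeLinearMap W) h
  let f := DirectSum.toModule ℂ (ZMod m) V
    fun j => (W (j + 1)).subtype ∘ₗ (ψ j).toLinearMap
  refine ⟨f ∘ₗ e.symm.toLinearMap, fun j w => ?_⟩
  have he : e.symm (w : V) = DirectSum.lof ℂ (ZMod m) (fun j => W j) j w := by
    rw [LinearEquiv.symm_apply_eq]
    exact (DirectSum.coeLinearMap_lof W j w).symm
  simp [he, f]

variable {ψ : ∀ j : ZMod m, W j ≃ₗ[ℂ] W (j + 1)} {P : Module.End ℂ V}

theorem coe_Psi_apply (hP : ∀ (j : ZMod m) (w : W j), P w = ψ j w) (j : ZMod m) (k : ℕ)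
    (w : W j) : (Psi W ψ j k w : V) = (P ^ k) w := by
  induction k with
  | zero => simp [Psi]
  | succ k ih =>
    rw [pow_succ', Module.End.mul_apply, ← ih, hP]
    simp [Psi]

theorem pow_apply_mem (hP : ∀ (j : ZMod m) (w : W j), P w = ψ j w) {j : ZMod m} (k : ℕ)
    {w : V} (hw : w ∈ W j) : (P ^ k) w ∈ W (j + k) := by
  rw [← coe_Psi_apply hP j k ⟨w, hw⟩]
  exact Subtype.property _

theorem eq_zero_of_pow_apply_eq_zero (hP : ∀ (j : ZMod m) (w : W j), P w = ψ j w)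
    {j : ZMod m} (k : ℕ) {w : V} (hw : w ∈ W j) (h : (P ^ k) w = 0) : w = 0 := by
  rw [← coe_Psi_apply hP j k ⟨w, hw⟩] at h
  simpa using h

theorem span_sub_eq_range (hSpan : (⨆ j, W j) = ⊤)
    (hP : ∀ (j : ZMod m) (w : W j), P w = ψ j w) :
    Submodule.span ℂ {v : V | ∃ (j : ZMod m) (w : W j), v = (w : V) - (ψ j w : V)} =
      LinearMap.range (1 - P) := by
  apply le_antisymm
  · rw [Submodule.span_le]
    rintro _ ⟨j, w, rfl⟩
    exact ⟨w, by simp [hP]⟩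
  · rw [LinearMap.range_eq_map, ← hSpan, Submodule.map_iSup, iSup_le_iff]
    rintro j _ ⟨w, hw, rfl⟩
    exact Submodule.subset_span ⟨j, ⟨w, hw⟩, by simp [← hP]⟩

theorem sub_pow_apply_mem_range (P : Module.End ℂ V) (k : ℕ) (w : V) :
    w - (P ^ k) w ∈ LinearMap.range (1 - P) := by
  refine ⟨(∑ i ∈ Finset.range k, P ^ i) w, ?_⟩
  rw [← Module.End.mul_apply, mul_neg_geom_sum]
  simp

theorem exists_pow_apply_mem_zero [NeZero m] (hP : ∀ (j : ZMod m) (w : W j), P w = ψ j w)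
    (j : ZMod m) : ∃ k : ℕ, ∀ w ∈ W j, (P ^ k) w ∈ W 0 :=
  ⟨(-j).val, fun _ hw => by simpa using pow_apply_mem hP (-j).val hw⟩

theorem sup_range_eq_top [NeZero m] (hSpan : (⨆ j, W j) = ⊤)
    (hP : ∀ (j : ZMod m) (w : W j), P w = ψ j w) :
    W 0 ⊔ LinearMap.range (1 - P) = ⊤ := by
  rw [eq_top_iff, ← hSpan, iSup_le_iff]
  intro j w hw
  obtain ⟨k, hk⟩ := exists_pow_apply_mem_zero hP j
  exact Submodule.mem_sup.2
    ⟨_, hk w hw, _, sub_pow_apply_mem_range P k w, add_sub_cancel _ _⟩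

theorem disjoint_range_of_disjoint_zero [NeZero m]
    (hP : ∀ (j : ZMod m) (w : W j), P w = ψ j w)
    (h : Disjoint (W 0) (LinearMap.range (1 - P))) (j : ZMod m) :
    Disjoint (W j) (LinearMap.range (1 - P)) := by
  rw [Submodule.disjoint_def] at h ⊢
  intro w hw hwU
  obtain ⟨k, hk⟩ := exists_pow_apply_mem_zero hP j
  refine eq_zero_of_pow_apply_eq_zero hP k hw (h _ (hk w hw) ?_)
  simpa using sub_mem hwU (sub_pow_apply_mem_range P k w)

theorem disjoint_zero_range_of_pow_eq_one [NeZero m] (hIndep : iSupIndep W)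
    (hP : ∀ (j : ZMod m) (w : W j), P w = ψ j w) (hPm : P ^ m = 1) :
    Disjoint (W 0) (LinearMap.range (1 - P)) := by
  rw [Submodule.disjoint_def]
  rintro w hw ⟨v, hv⟩
  have hsum : (∑ i ∈ Finset.range m, P ^ i) w = 0 := by
    rw [← hv, ← Module.End.mul_apply, geom_sum_mul_neg, hPm]
    simp
  obtain ⟨n, rfl⟩ := Nat.exists_eq_succ_of_ne_zero (NeZero.ne m)
  rw [Finset.sum_range_succ', LinearMap.add_apply, pow_zero, Module.End.one_apply] at hsum
  refine (Submodule.disjoint_def.1 (hIndep 0)) w hw ?_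
  rw [eq_neg_of_add_eq_zero_right hsum, LinearMap.sum_apply]
  refine neg_mem (sum_mem fun i hi => ?_)
  have hi' : ((i + 1 : ℕ) : ZMod (n + 1)) ≠ 0 := by
    rw [Ne, ZMod.natCast_eq_zero_iff]
    exact Nat.not_dvd_of_pos_of_lt i.succ_pos (by simpa using hi)
  have := pow_apply_mem hP (i + 1) hw
  rw [zero_add] at this
  exact Submodule.mem_iSup_of_mem _ (Submodule.mem_iSup_of_mem hi' this)

theorem bijective_mkQ_comp_subtype_iff {p U : Submodule ℂ V} :
    Function.Bijective (U.mkQ.comp p.subtype) ↔ Disjoint p U ∧ p ⊔ U = ⊤ := by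
  refine and_congr ?_ ?_
  · rw [← LinearMap.ker_eq_bot, LinearMap.ker_comp, Submodule.ker_mkQ, ← Submodule.disjoint_iff_comap_eq_bot]
  · rw [← LinearMap.range_eq_top, LinearMap.range_comp, Submodule.range_subtype,
      Submodule.map_mkQ_eq_top, sup_comm]

theorem isClutch_iff_of_extends {N₂ : Type*} [Group N₂] [MulAction N₂ (ZMod m)]
    (ρ : N₂ →* (V ≃ₗ[ℂ] V)) (hSpan : (⨆ j, W j) = ⊤)
    (hWρ : ∀ (g : N₂) (j : ZMod m), (W j).map (ρ g).toLinearMap = W (g • j))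
    (hP : ∀ (j : ZMod m) (w : W j), P w = ψ j w) :
    IsClutch ρ W ψ ↔ P ^ m = 1 ∧ ∀ (j : ZMod m) (g : N₂), ∀ w ∈ W j,
      (P ^ (g • (j + 1) - g • j).val) (ρ g w) = ρ g (P w) := by
  refine and_congr ⟨fun h => ?_, fun h j w => by simp [coe_Psi_apply hP, h]⟩
    ⟨fun h j g w hw => ?_, fun h j g w₁ w₂ hw => ?_⟩
  · rw [← sub_eq_zero, ← LinearMap.ker_eq_top, eq_top_iff, ← hSpan, iSup_le_iff]
    intro j w hw
    have := h j ⟨w, hw⟩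
    rw [coe_Psi_apply hP] at this
    simpa [sub_eq_zero] using this
  · have hj : w ∈ W (g⁻¹ • g • j) := by rwa [inv_smul_smul]
    have hg : ρ g w ∈ W (g • j) := hWρ g j ▸ Submodule.mem_map_of_mem hw
    have := h (g • j) g ⟨_, hg⟩ ⟨w, hj⟩ (by simp)
    rw [coe_Psi_apply hP, ← hP] at this
    simpa using this
  · have := h (g⁻¹ • j) g w₂ w₂.2
    rw [coe_Psi_apply hP, ← hP, ← this, smul_inv_smul, hw]
    simp

end Aux

/-- A pointwise preclutching map `ψ` is an equivariant pointwise clutching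
map if and only if the subspace `U_ψ` (spanned by all `w - ψ_j w`) is `ρ`-invariant and the
composite `ι_ψ : W 0 → V ⧸ U_ψ` of the inclusion and the quotient map is bijective. -/
theorem stmt_7 {N₂ : Type*} [Group N₂] [MulAction N₂ (ZMod m)]
    {V : Type*} [AddCommGroup V] [Module ℂ V] [FiniteDimensional ℂ V]
    (hm : 2 ≤ m)
    (ρ : N₂ →* (V ≃ₗ[ℂ] V)) (W : ZMod m → Submodule ℂ V)
    (hIndep : ∀ j : ZMod m, Disjoint (W j) (⨆ k : ZMod m, ⨆ (_ : k ≠ j), W k))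
    (hSpan : (⨆ j : ZMod m, W j) = ⊤)
    (hWρ : ∀ (g : N₂) (j : ZMod m), (W j).map (ρ g).toLinearMap = W (g • j))
    (hfib : ∀ j j' : ZMod m, ∃ e : W j ≃ₗ[ℂ] W j',
      ∀ g : N₂, InKernel (m := m) N₂ g → IsEquivariantOn ρ e g)
    (ψ : ∀ j : ZMod m, W j ≃ₗ[ℂ] W (j + 1))
    (U : Submodule ℂ V)
    (hU : U = Submodule.span ℂ
      {v : V | ∃ (j : ZMod m) (w : W j), v = (w : V) - ((ψ j) w : V)}) :
    IsClutch ρ W ψ ↔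
      ((∀ g : N₂, U.map (ρ g).toLinearMap = U) ∧
        Function.Bijective (U.mkQ.comp (W 0).subtype)) := by
  have : NeZero m := ⟨by omega⟩
  obtain ⟨P, hP⟩ := exists_endomorphism_extending hIndep hSpan ψ
  rw [span_sub_eq_range hSpan hP] at hU
  subst hU
  rw [isClutch_iff_of_extends ρ hSpan hWρ hP, bijective_mkQ_comp_subtype_iff]
  constructor
  · rintro ⟨hPm, hPρ⟩
    refine ⟨fun g => ?_, disjoint_zero_range_of_pow_eq_one hIndep hP hPm,
      sup_range_eq_top hSpan hP⟩
    have hle : ∀ g : N₂, (LinearMap.range (1 - P)).map (ρ g).toLinearMap ≤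
        LinearMap.range (1 - P) := by
      intro g
      have hcomap : (⊤ : Submodule ℂ V) ≤
          ((LinearMap.range (1 - P)).comap (ρ g).toLinearMap).comap (1 - P) := by
        rw [← hSpan, iSup_le_iff]
        intro j w hw
        simpa [-LinearMap.mem_range, ← hPρ j g w hw] using sub_pow_apply_mem_range P _ (ρ g w)
      rintro _ ⟨_, ⟨v, rfl⟩, rfl⟩
      exact hcomap (Submodule.mem_top (x := v))
    refine le_antisymm (hle g) fun u hu => ?_
    exact ⟨ρ g⁻¹ u, hle g⁻¹ (Submodule.mem_map_of_mem hu),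
      by simp⟩
  · rintro ⟨hinv, hdisj, -⟩
    have hdj := disjoint_range_of_disjoint_zero hP hdisj
    refine ⟨?_, fun j g w hw => ?_⟩
    · rw [← sub_eq_zero, ← LinearMap.ker_eq_top, eq_top_iff, ← hSpan, iSup_le_iff]
      intro j w hw
      refine Submodule.disjoint_def.1 (hdj j) _ (sub_mem ?_ hw) ?_
      · simpa using pow_apply_mem hP m hw
      · rw [← neg_mem_iff]
        simpa using sub_pow_apply_mem_range P m w
    · have hg : ρ g w ∈ W (g • j) := hWρ g j ▸ Submodule.mem_map_of_mem hw
      have hPw : P w ∈ W (j + 1) := by simpa using pow_apply_mem hP 1 hw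
      have hmem : ρ g (P w) ∈ W (g • (j + 1)) := hWρ g _ ▸ Submodule.mem_map_of_mem hPw
      have hU : ρ g (w - P w) ∈ LinearMap.range (1 - P) := by
        rw [← hinv g]
        exact Submodule.mem_map_of_mem ⟨w, by simp⟩
      rw [← sub_eq_zero]
      refine Submodule.disjoint_def.1 (hdj (g • (j + 1))) _ (sub_mem ?_ hmem) ?_
      · simpa using pow_apply_mem hP (g • (j + 1) - g • j).val hg
      · simpa [map_sub] using
          sub_mem hU (sub_pow_apply_mem_range P (g • (j + 1) - g • j).val (ρ g w))

end EqClutch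
end
end

section
/- Suppose a₀ ∈ N₂ satisfies a₀ • j = j + 1 for all j ∈ ZMod m and N₂ is generated by N₀ ∪ {a₀} (so N₂/N₀ ≅ ℤ/m and N₁ = N₀). Then a pointwise preclutching map ψ is an equivariant pointwise clutching map if and only if: Ψ₀^m = id, ψ₀ is N₀-equivariant, and for every j ∈ ZMod m one has ψ_j = ρ(a₀)ᵏ ∘ ψ₀ ∘ ρ(a₀)⁻ᵏ (as maps W j → W (j+1)), where k ∈ {0,…,m−1} represents j. -/
noncomputable section

namespace EqClutch

variable {m : ℕ}

section Helpers

variable {N₂ : Type*} [Group N₂] [MulAction N₂ (ZMod m)]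
  {V : Type*} [AddCommGroup V] [Module ℂ V]

theorem coe_apply_congr {W : ZMod m → Submodule ℂ V} (ψ : ∀ j : ZMod m, W j ≃ₗ[ℂ] W (j + 1))
    {j j' : ZMod m} (h : j = j') (w : W j) (w' : W j') (hw : (w : V) = w') :
    (ψ j w : V) = ψ j' w' := by
  subst h
  rw [Subtype.ext hw]

theorem coe_Psi_succ {W : ZMod m → Submodule ℂ V} (ψ : ∀ j : ZMod m, W j ≃ₗ[ℂ] W (j + 1))
    (j : ZMod m) (k : ℕ) (w : W j) :
    (Psi W ψ j (k + 1) w : V) = ψ (j + (k : ZMod m)) (Psi W ψ j k w) := rfl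

theorem coe_Psi_one {W : ZMod m → Submodule ℂ V} (ψ : ∀ j : ZMod m, W j ≃ₗ[ℂ] W (j + 1))
    (j : ZMod m) (w : W j) : (Psi W ψ j 1 w : V) = ψ j w := by
  rw [coe_Psi_succ]
  exact coe_apply_congr ψ (by simp) _ _ rfl

/-- The family `ψ` commutes with the action of all of `N₂`. -/
def CommutesWithAction (ρ : N₂ →* (V ≃ₗ[ℂ] V)) (W : ZMod m → Submodule ℂ V)
    (ψ : ∀ j : ZMod m, W j ≃ₗ[ℂ] W (j + 1)) : Prop :=
  ∀ (g : N₂) (j j' : ZMod m) (w : W j) (w' : W j'), j' = g • j → (w' : V) = ρ g w →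
    (ψ j' w' : V) = ρ g (ψ j w)

/-- If `N₂` acts by translations, the iterates of a commuting family commute with `N₂`. -/
theorem CommutesWithAction.coe_Psi {ρ : N₂ →* (V ≃ₗ[ℂ] V)} {W : ZMod m → Submodule ℂ V}
    {ψ : ∀ j : ZMod m, W j ≃ₗ[ℂ] W (j + 1)} (hψ : CommutesWithAction ρ W ψ)
    (htr : ∀ (g : N₂) (i j : ZMod m), g • (i + j) = g • i + j)
    (g : N₂) {j j' : ZMod m} (w : W j) (w' : W j') (hj : j' = g • j) (hw : (w' : V) = ρ g w)
    (k : ℕ) : (Psi W ψ j' k w' : V) = ρ g (Psi W ψ j k w) := by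
  induction k with
  | zero => exact hw
  | succ k ih =>
    rw [coe_Psi_succ, coe_Psi_succ]
    exact hψ g _ _ _ _ (by rw [htr, hj]) ih

theorem smul_add_of_closure_eq_top {a₀ : N₂} (ha₀ : ∀ j : ZMod m, a₀ • j = j + 1)
    (hgen : Subgroup.closure ({g : N₂ | InKernel (m := m) N₂ g} ∪ {a₀}) = ⊤)
    (g : N₂) (i j : ZMod m) : g • (i + j) = g • i + j := by
  have hg : g ∈ Subgroup.closure ({g : N₂ | InKernel (m := m) N₂ g} ∪ {a₀}) := by
    rw [hgen]; trivial
  induction hg using Subgroup.closure_induction generalizing i j with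
  | mem x hx =>
    rcases hx with hx | hx
    · rw [hx, hx]
    · rw [Set.mem_singleton_iff.mp hx, ha₀, ha₀]; ring
  | one => simp
  | mul x y _ _ hx hy => rw [mul_smul, mul_smul, hy, hx]
  | inv x _ hx => rw [inv_smul_eq_iff, hx, smul_inv_smul]

theorem pow_smul_eq_add {a₀ : N₂} (ha₀ : ∀ j : ZMod m, a₀ • j = j + 1) (k : ℕ) (j : ZMod m) :
    a₀ ^ k • j = j + k := by
  induction k with
  | zero => simp
  | succ k ih => rw [pow_succ', mul_smul, ih, ha₀]; push_cast; ring

theorem apply_mem {ρ : N₂ →* (V ≃ₗ[ℂ] V)} {W : ZMod m → Submodule ℂ V}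
    (hWρ : ∀ (g : N₂) (j : ZMod m), (W j).map (ρ g).toLinearMap = W (g • j))
    (g : N₂) {j j' : ZMod m} (h : j' = g • j) (w : W j) : ρ g w ∈ W j' := by
  rw [h, ← hWρ]
  exact Submodule.mem_map_of_mem w.2

theorem map_inv_apply_map_apply (ρ : N₂ →* (V ≃ₗ[ℂ] V)) (g : N₂) (v : V) :
    ρ g⁻¹ (ρ g v) = v := by
  rw [← LinearEquiv.mul_apply, ← map_mul]; simp

/-- For a translation action, condition (2) of `IsClutch` says that `ψ` commutes with `N₂`. -/
theorem isClutch_iff_commutesWithAction (hm : 2 ≤ m) (ρ : N₂ →* (V ≃ₗ[ℂ] V))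
    (W : ZMod m → Submodule ℂ V) (ψ : ∀ j : ZMod m, W j ≃ₗ[ℂ] W (j + 1))
    (htr : ∀ (g : N₂) (i j : ZMod m), g • (i + j) = g • i + j) :
    IsClutch ρ W ψ ↔
      (∀ (j : ZMod m) (w : W j), (Psi W ψ j m w : V) = w) ∧ CommutesWithAction ρ W ψ := by
  have : Fact (1 < m) := ⟨hm⟩
  have hk : ∀ (g : N₂) (j : ZMod m), (g • (g⁻¹ • j + 1) - j).val = 1 := fun g j ↦ by
    rw [htr, smul_inv_smul, add_sub_cancel_left, ZMod.val_one]
  refine and_congr_right fun _ ↦ ⟨fun h g j j' w w' hj hw ↦ ?_, fun h j g w₁ w₂ hw ↦ ?_⟩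
  · have hj' : j = g⁻¹ • j' := by rw [hj, inv_smul_smul]
    subst hj'
    have := h j' g w' w (by rw [hw, map_inv_apply_map_apply])
    rwa [hk, coe_Psi_one] at this
  · rw [hk, coe_Psi_one]
    refine h g _ _ _ _ (by rw [smul_inv_smul]) ?_
    simp [hw]

end Helpers

/-- Suppose `a₀ • j = j + 1` for all `j` and `N₂ = ⟨N₀, a₀⟩`.  Then a
pointwise preclutching map `ψ` is an equivariant pointwise clutching map if and only if
`Ψ₀^m = id`, `ψ₀` is `N₀`-equivariant, and `ψ_j = ρ(a₀)^k ∘ ψ₀ ∘ ρ(a₀)^{-k}` for every `j`,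
where `k ∈ {0, …, m-1}` represents `j`. -/
theorem stmt_8 {N₂ : Type*} [Group N₂] [MulAction N₂ (ZMod m)]
    {V : Type*} [AddCommGroup V] [Module ℂ V] [FiniteDimensional ℂ V]
    (hm : 2 ≤ m)
    (ρ : N₂ →* (V ≃ₗ[ℂ] V)) (W : ZMod m → Submodule ℂ V)
    (hIndep : ∀ j : ZMod m, Disjoint (W j) (⨆ k : ZMod m, ⨆ (_ : k ≠ j), W k))
    (hSpan : (⨆ j : ZMod m, W j) = ⊤)
    (hWρ : ∀ (g : N₂) (j : ZMod m), (W j).map (ρ g).toLinearMap = W (g • j))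
    (hfib : ∀ j j' : ZMod m, ∃ e : W j ≃ₗ[ℂ] W j',
      ∀ g : N₂, InKernel (m := m) N₂ g → IsEquivariantOn ρ e g)
    (a₀ : N₂) (ha₀ : ∀ j : ZMod m, a₀ • j = j + 1)
    (hgen : Subgroup.closure ({g : N₂ | InKernel (m := m) N₂ g} ∪ {a₀}) = ⊤)
    (ψ : ∀ j : ZMod m, W j ≃ₗ[ℂ] W (j + 1)) :
    IsClutch ρ W ψ ↔
      ((∀ w : W 0, ((Psi W ψ 0 m) w : V) = (w : V)) ∧
        (∀ g : N₂, InKernel (m := m) N₂ g → IsEquivariantOn ρ (ψ 0) g) ∧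
        (∀ (j : ZMod m) (w : W j) (w₀ : W 0),
          (w₀ : V) = ρ (a₀ ^ j.val)⁻¹ (w : V) →
          ((ψ j) w : V) = ρ (a₀ ^ j.val) (((ψ 0) w₀ : V)))) := by
  have : NeZero m := ⟨by omega⟩
  have htr := smul_add_of_closure_eq_top ha₀ hgen
  have hpow : ∀ j : ZMod m, j = a₀ ^ j.val • (0 : ZMod m) := fun j ↦ by
    rw [pow_smul_eq_add ha₀]; simp
  rw [isClutch_iff_commutesWithAction hm ρ W ψ htr]
  constructor
  · rintro ⟨h1, h2⟩
    refine ⟨h1 0, fun g hg w w' hw ↦ h2 g 0 0 w w' (hg 0).symm hw, fun j w w₀ hw ↦ ?_⟩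
    refine h2 (a₀ ^ j.val) 0 j w₀ w (hpow j) ?_
    rw [hw]
    simp
  · rintro ⟨h1, h2, h3⟩
    have hψ : CommutesWithAction ρ W ψ := by
      intro g j j' w w' hj hw
      have h0 : ∀ i : ZMod m, 0 = (a₀ ^ i.val)⁻¹ • i := fun i ↦ by
        rw [eq_inv_smul_iff, ← hpow]
      let u : W 0 := ⟨_, apply_mem hWρ (a₀ ^ j.val)⁻¹ (h0 j) w⟩
      let u' : W 0 := ⟨_, apply_mem hWρ (a₀ ^ j'.val)⁻¹ (h0 j') w'⟩
      rw [h3 j w u rfl, h3 j' w' u' rfl]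
      have hker : InKernel (m := m) N₂ ((a₀ ^ j'.val)⁻¹ * g * a₀ ^ j.val) := by
        intro i
        have h00 : ((a₀ ^ j'.val)⁻¹ * g * a₀ ^ j.val) • (0 : ZMod m) = 0 := by
          rw [mul_smul, mul_smul, ← hpow, ← hj, ← h0]
        rw [← zero_add i, htr, h00]
      have := h2 _ hker u u' (by
        simp only [u, u', hw, ← LinearEquiv.mul_apply, ← map_mul]
        simp [mul_assoc])
      rw [this]
      simp only [← LinearEquiv.mul_apply, ← map_mul]
      simp [mul_assoc]
    refine ⟨fun j w ↦ ?_, hψ⟩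
    have h0 : 0 = (a₀ ^ j.val)⁻¹ • j := by rw [eq_inv_smul_iff, ← hpow]
    have h := hψ.coe_Psi htr (a₀ ^ j.val)⁻¹ w ⟨_, apply_mem hWρ (a₀ ^ j.val)⁻¹ h0 w⟩ h0 rfl m
    rw [h1] at h
    exact ((ρ (a₀ ^ j.val)⁻¹).injective h).symm

end EqClutch
end
end

section
/- Suppose a₀, b₀ ∈ N₂ satisfy a₀ • j = j + 1 and b₀ • j = −j + 1 for all j ∈ ZMod m, and N₂ is generated by N₀ ∪ {a₀, b₀} (so N₂/N₀ ≅ D_m and N₁ = ⟨N₀, b₀a₀⟩). Then a pointwise preclutching map ψ is an equivariant pointwise clutching map if and only if: Ψ₀^m = id, ψ₀ is N₀-equivariant, ψ₀⁻¹ = ρ(b₀) ∘ ψ₀ ∘ ρ(b₀)⁻¹ as maps W 1 → W 0, and for every j ∈ ZMod m one has ψ_j = ρ(a₀)ᵏ ∘ ψ₀ ∘ ρ(a₀)⁻ᵏ, where k ∈ {0,…,m−1} represents j. -/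
noncomputable section

namespace EqClutch

variable {m : ℕ}

theorem exists_linearMap_extending {V : Type*} [AddCommGroup V] [Module ℂ V]
    {ι : Type*} {W : ι → Submodule ℂ V} (hIndep : iSupIndep W) (hSpan : (⨆ j, W j) = ⊤)
    (f : ∀ j, W j →ₗ[ℂ] V) :
    ∃ T : V →ₗ[ℂ] V, ∀ j (w : W j), T (w : V) = f j w := by
  classical
  have hint : DirectSum.IsInternal W :=
    DirectSum.isInternal_submodule_of_iSupIndep_of_iSup_eq_top hIndep hSpan
  let e := LinearEquiv.ofBijective (DirectSum.coeLinearMap W) hint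
  refine ⟨(DirectSum.toModule ℂ ι V f) ∘ₗ e.symm.toLinearMap, fun j w => ?_⟩
  have h : e.symm (w : V) = DirectSum.lof ℂ ι (fun j => W j) j w := by
    rw [LinearEquiv.symm_apply_eq]
    exact (DirectSum.coeLinearMap_lof W j w).symm
  simp [h]

theorem linearEquiv_ext_of_iSup_eq_top {V : Type*} [AddCommGroup V] [Module ℂ V]
    {ι : Type*} {W : ι → Submodule ℂ V} (hSpan : (⨆ j, W j) = ⊤)
    {S T : V ≃ₗ[ℂ] V} (h : ∀ j, ∀ x ∈ W j, S x = T x) : S = T := by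
  ext x
  have hle : (⨆ j, W j) ≤ LinearMap.eqLocus S.toLinearMap T.toLinearMap :=
    iSup_le fun j x hx => h j x hx
  exact hle (hSpan ▸ Submodule.mem_top)

/-- A pointwise preclutching map is the restriction of a linear automorphism of the total
space. -/
theorem exists_total_linearEquiv {V : Type*} [AddCommGroup V] [Module ℂ V]
    [FiniteDimensional ℂ V] {W : ZMod m → Submodule ℂ V} (hIndep : iSupIndep W)
    (hSpan : (⨆ j, W j) = ⊤) (ψ : ∀ j : ZMod m, W j ≃ₗ[ℂ] W (j + 1)) :
    ∃ T : V ≃ₗ[ℂ] V, ∀ j (w : W j), (ψ j w : V) = T (w : V) := by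
  obtain ⟨T, hT⟩ := exists_linearMap_extending hIndep hSpan
    fun j => (W (j + 1)).subtype ∘ₗ (ψ j).toLinearMap
  have hsurj : Function.Surjective T := by
    rw [← LinearMap.range_eq_top, eq_top_iff, ← hSpan]
    refine iSup_le fun j x hx => ?_
    obtain ⟨i, rfl⟩ : ∃ i, j = i + 1 := ⟨j - 1, by ring⟩
    exact ⟨(ψ i).symm ⟨x, hx⟩, by simp [hT]⟩
  exact ⟨LinearEquiv.ofBijective T ⟨LinearMap.injective_iff_surjective.2 hsurj, hsurj⟩,
    fun j w => (hT j w).symm⟩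

theorem Psi_apply_eq_pow {V : Type*} [AddCommGroup V] [Module ℂ V]
    {W : ZMod m → Submodule ℂ V} {ψ : ∀ j : ZMod m, W j ≃ₗ[ℂ] W (j + 1)}
    {T : V ≃ₗ[ℂ] V} (hT : ∀ j (w : W j), (ψ j w : V) = T (w : V))
    (j : ZMod m) (k : ℕ) (w : W j) : (Psi W ψ j k w : V) = (T ^ k) (w : V) := by
  induction k with
  | zero => simp [Psi]
  | succ k ih => simp [Psi, hT, ih, pow_succ']

section TotalMap

variable {N₂ : Type*} [Group N₂] [MulAction N₂ (ZMod m)]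
  {V : Type*} [AddCommGroup V] [Module ℂ V]
  {ρ : N₂ →* (V ≃ₗ[ℂ] V)} {W : ZMod m → Submodule ℂ V}

theorem map_mem_smul (hWρ : ∀ (g : N₂) (j : ZMod m), (W j).map (ρ g).toLinearMap = W (g • j))
    (g : N₂) {j : ZMod m} {x : V} (hx : x ∈ W j) : ρ g x ∈ W (g • j) :=
  hWρ g j ▸ Submodule.mem_map_of_mem hx

/-- For the total automorphism `T`, the clutching conditions are identities in `GL(V)`. -/
theorem isClutch_iff_total (hSpan : (⨆ j, W j) = ⊤)
    (hWρ : ∀ (g : N₂) (j : ZMod m), (W j).map (ρ g).toLinearMap = W (g • j))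
    {ψ : ∀ j : ZMod m, W j ≃ₗ[ℂ] W (j + 1)}
    {T : V ≃ₗ[ℂ] V} (hT : ∀ j (w : W j), (ψ j w : V) = T (w : V)) :
    IsClutch ρ W ψ ↔ T ^ m = 1 ∧ ∀ (g : N₂) (j : ZMod m), ∀ x ∈ W j,
      (T ^ (g • (g⁻¹ • j + 1) - j).val) x = (ρ g * T * (ρ g)⁻¹) x := by
  unfold IsClutch
  refine and_congr ⟨fun h => ?_, fun h j w => ?_⟩ ⟨fun h g j x hx => ?_, fun h j g w w' hw => ?_⟩
  · refine linearEquiv_ext_of_iSup_eq_top hSpan fun j x hx => ?_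
    simpa [Psi_apply_eq_pow hT] using h j ⟨x, hx⟩
  · simp [Psi_apply_eq_pow hT, h]
  · have := h j g ⟨x, hx⟩ ⟨ρ g⁻¹ x, map_mem_smul hWρ _ hx⟩ rfl
    rw [Psi_apply_eq_pow hT, hT] at this
    simpa only [map_inv, LinearEquiv.mul_apply] using this
  · rw [Psi_apply_eq_pow hT, hT, hw, h g j _ w.2, map_inv]
    rfl

end TotalMap

/-- Suppose `a₀ • j = j + 1`, `b₀ • j = -j + 1` for all `j` and
`N₂ = ⟨N₀, a₀, b₀⟩` (so `N₂/N₀ ≅ D_m`).  Then a pointwise preclutching map `ψ` is an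
equivariant pointwise clutching map if and only if `Ψ₀^m = id`, `ψ₀` is `N₀`-equivariant,
`ψ₀⁻¹ = ρ(b₀) ∘ ψ₀ ∘ ρ(b₀)⁻¹` as maps `W 1 → W 0`, and
`ψ_j = ρ(a₀)^k ∘ ψ₀ ∘ ρ(a₀)^{-k}` for every `j`, where `k ∈ {0, …, m-1}` represents `j`. -/
theorem stmt_10 {N₂ : Type*} [Group N₂] [MulAction N₂ (ZMod m)]
    {V : Type*} [AddCommGroup V] [Module ℂ V] [FiniteDimensional ℂ V]
    (hm : 2 ≤ m)
    (ρ : N₂ →* (V ≃ₗ[ℂ] V)) (W : ZMod m → Submodule ℂ V)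
    (hIndep : ∀ j : ZMod m, Disjoint (W j) (⨆ k : ZMod m, ⨆ (_ : k ≠ j), W k))
    (hSpan : (⨆ j : ZMod m, W j) = ⊤)
    (hWρ : ∀ (g : N₂) (j : ZMod m), (W j).map (ρ g).toLinearMap = W (g • j))
    (hfib : ∀ j j' : ZMod m, ∃ e : W j ≃ₗ[ℂ] W j',
      ∀ g : N₂, InKernel (m := m) N₂ g → IsEquivariantOn ρ e g)
    (a₀ b₀ : N₂) (ha₀ : ∀ j : ZMod m, a₀ • j = j + 1)
    (hb₀ : ∀ j : ZMod m, b₀ • j = -j + 1)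
    (hgen : Subgroup.closure ({g : N₂ | InKernel (m := m) N₂ g} ∪ {a₀, b₀}) = ⊤)
    (ψ : ∀ j : ZMod m, W j ≃ₗ[ℂ] W (j + 1)) :
    IsClutch ρ W ψ ↔
      ((∀ w : W 0, ((Psi W ψ 0 m) w : V) = (w : V)) ∧
        (∀ g : N₂, InKernel (m := m) N₂ g → IsEquivariantOn ρ (ψ 0) g) ∧
        (∀ (u : W (0 + 1)) (w₀ : W 0),
          (w₀ : V) = ρ b₀⁻¹ (u : V) →
          (((ψ 0).symm u : V) = ρ b₀ (((ψ 0) w₀ : V)))) ∧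
        (∀ (j : ZMod m) (w : W j) (w₀ : W 0),
          (w₀ : V) = ρ (a₀ ^ j.val)⁻¹ (w : V) →
          ((ψ j) w : V) = ρ (a₀ ^ j.val) (((ψ 0) w₀ : V)))) := by
  have : NeZero m := ⟨by omega⟩
  have : Fact (1 < m) := ⟨by omega⟩
  obtain ⟨T, hT⟩ := exists_total_linearEquiv hIndep hSpan ψ
  have hPsi := Psi_apply_eq_pow hT
  rw [isClutch_iff_total hSpan hWρ hT]
  have hsymm (u : W (0 + 1)) : ((ψ 0).symm u : V) = T⁻¹ (u : V) := by
    have h := hT 0 ((ψ 0).symm u)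
    rw [LinearEquiv.apply_symm_apply] at h
    rw [h]
    exact (T.symm_apply_apply _).symm
  have hapow (k : ℕ) (j : ZMod m) : (a₀ ^ k) • j = j + k := by
    induction k with
    | zero => simp
    | succ k ih => rw [pow_succ', mul_smul, ih, ha₀]; push_cast; ring
  constructor
  · rintro ⟨hm1, hg⟩
    have hTinv : T ^ (m - 1) = T⁻¹ := by
      rw [eq_inv_iff_mul_eq_one, ← pow_succ, Nat.sub_add_cancel (by omega), hm1]
    have ha : ρ a₀ * T * (ρ a₀)⁻¹ = T := by
      refine linearEquiv_ext_of_iSup_eq_top hSpan fun j x hx => ?_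
      have h := hg a₀ j x hx
      rw [show a₀ • (a₀⁻¹ • j + 1) - j = 1 by
        rw [← ha₀, smul_inv_smul, ha₀]; ring, ZMod.val_one, pow_one] at h
      exact h.symm
    have hac : Commute (ρ a₀) T := mul_inv_eq_iff_eq_mul.1 ha
    refine ⟨fun w => by simp [hPsi, hm1], fun g hgk w w' hw => ?_, fun u w₀ hw => ?_,
      fun j w w₀ hw => ?_⟩
    · have hgk' : g⁻¹ • (0 : ZMod m) = 0 := by rw [inv_smul_eq_iff, hgk]
      have h := hg g 0 w' w'.2
      rw [hgk', hgk, zero_add, sub_zero, ZMod.val_one, pow_one, hw] at h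
      rw [hT, hT, hw, h]
      simp [LinearEquiv.mul_apply]
    · have hb : b₀⁻¹ • (0 + 1 : ZMod m) = 0 := by rw [inv_smul_eq_iff, hb₀]; ring
      have h := hg b₀ (0 + 1) u u.2
      rw [hb, hb₀, show -(0 + 1 : ZMod m) + 1 - (0 + 1) = -1 by ring,
        ZMod.val_neg_of_ne_zero, ZMod.val_one, hTinv] at h
      rw [hsymm, hT, hw, h, map_inv]
      rfl
    · have h : ρ (a₀ ^ j.val) * T * (ρ (a₀ ^ j.val))⁻¹ = T := by
        rw [mul_inv_eq_iff_eq_mul, map_pow]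
        exact hac.pow_left _
      rw [hT, hT, hw, map_inv]
      exact (LinearEquiv.congr_fun h _).symm
  · rintro ⟨hm0, hN, hb, ha⟩
    have hN0 {g : N₂} (hgk : InKernel (m := m) N₂ g) {x : V} (hx : x ∈ W 0) :
        T (ρ g x) = ρ g (T x) := by
      have hx' : ρ g x ∈ W 0 := hgk 0 ▸ map_mem_smul hWρ g hx
      have h := hN g hgk ⟨x, hx⟩ ⟨ρ g x, hx'⟩ rfl
      rwa [hT, hT] at h
    have hapow0 (j : ZMod m) {x : V} (hx : x ∈ W 0) :
        T (ρ (a₀ ^ j.val) x) = ρ (a₀ ^ j.val) (T x) := by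
      have hx' : ρ (a₀ ^ j.val) x ∈ W j := by
        have h := map_mem_smul hWρ (a₀ ^ j.val) hx
        rwa [hapow, zero_add, ZMod.natCast_zmod_val] at h
      have h := ha j ⟨_, hx'⟩ ⟨x, hx⟩ (by
        rw [map_inv]; exact ((ρ (a₀ ^ j.val)).symm_apply_apply x).symm)
      rwa [hT, hT] at h
    have hexists (j : ZMod m) {x : V} (hx : x ∈ W j) :
        ∃ y ∈ W 0, x = ρ (a₀ ^ j.val) y := by
      have h := hWρ (a₀ ^ j.val) 0
      rw [hapow, zero_add, ZMod.natCast_zmod_val] at h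
      rw [← h] at hx
      obtain ⟨y, hy, rfl⟩ := hx
      exact ⟨y, hy, rfl⟩
    have hac : Commute T (ρ a₀) := by
      refine linearEquiv_ext_of_iSup_eq_top hSpan fun j x hx => ?_
      obtain ⟨y, hy, rfl⟩ := hexists j hx
      have hmul (z : V) : ρ a₀ (ρ (a₀ ^ j.val) z) = ρ (a₀ ^ (j.val + 1)) z := by
        rw [pow_succ', map_mul]; rfl
      change T (ρ a₀ (ρ (a₀ ^ j.val) y)) = ρ a₀ (T (ρ (a₀ ^ j.val) y))
      rw [hapow0 j hy, hmul, hmul]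
      have hlt := ZMod.val_lt j
      rcases Nat.lt_or_ge (j.val + 1) m with hj | hj
      · have h := hapow0 ((j.val + 1 : ℕ) : ZMod m) hy
        rwa [ZMod.val_cast_of_lt hj] at h
      · have hjm : j.val + 1 = m := by omega
        rw [hjm]
        exact hN0 (fun i => by simp [hapow]) hy
    have hacp (k : ℕ) : Commute T (ρ (a₀ ^ k)) := by
      rw [map_pow]; exact hac.pow_right k
    have hTm : T ^ m = 1 := by
      refine linearEquiv_ext_of_iSup_eq_top hSpan fun j x hx => ?_
      obtain ⟨y, hy, rfl⟩ := hexists j hx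
      have h := LinearEquiv.congr_fun ((hacp j.val).pow_left m).eq y
      have h0 := hm0 ⟨y, hy⟩
      rw [hPsi] at h0
      simp only [LinearEquiv.mul_apply] at h
      rw [h, h0]
      rfl
    have hTinv : T ^ (m - 1) = T⁻¹ := by
      rw [eq_inv_iff_mul_eq_one, ← pow_succ, Nat.sub_add_cancel (by omega), hTm]
    have hNc {g : N₂} (hgk : InKernel (m := m) N₂ g) : Commute T (ρ g) := by
      refine linearEquiv_ext_of_iSup_eq_top hSpan fun j x hx => ?_
      obtain ⟨y, hy, rfl⟩ := hexists j hx
      have hgk' : InKernel (m := m) N₂ ((a₀ ^ j.val)⁻¹ * g * a₀ ^ j.val) := fun i => by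
        rw [mul_smul, mul_smul, hgk, inv_smul_smul]
      have hmul (z : V) : ρ g (ρ (a₀ ^ j.val) z) =
          ρ (a₀ ^ j.val) (ρ ((a₀ ^ j.val)⁻¹ * g * a₀ ^ j.val) z) := by
        simp only [← LinearEquiv.mul_apply, ← map_mul]
        congr 2; group
      have hc (z : V) : T (ρ (a₀ ^ j.val) z) = ρ (a₀ ^ j.val) (T z) :=
        LinearEquiv.congr_fun (hacp j.val).eq z
      change T (ρ g (ρ (a₀ ^ j.val) y)) = ρ g (T (ρ (a₀ ^ j.val) y))
      rw [hmul, hc, hc, hmul, hN0 hgk' hy]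
    have hb1 {y : V} (hy : y ∈ W 0) : T⁻¹ (ρ b₀ y) = ρ b₀ (T y) := by
      have hy' : ρ b₀ y ∈ W (0 + 1) := by
        have h := map_mem_smul hWρ b₀ hy
        rwa [hb₀, neg_zero] at h
      have h := hb ⟨_, hy'⟩ ⟨y, hy⟩ (by
        rw [map_inv]; exact ((ρ b₀).symm_apply_apply y).symm)
      rwa [hsymm, hT] at h
    have hbc : T⁻¹ * ρ b₀ = ρ b₀ * T := by
      refine linearEquiv_ext_of_iSup_eq_top hSpan fun j x hx => ?_
      obtain ⟨y, hy, rfl⟩ := hexists j hx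
      set a := a₀ ^ j.val with ha_def
      have hak (i : ZMod m) : a • i = i + j := by rw [hapow, ZMod.natCast_zmod_val]
      have hk : InKernel (m := m) N₂ (a * b₀ * a * b₀⁻¹) := fun i => by
        have hi : b₀ • (b₀⁻¹ • i) = i := smul_inv_smul _ _
        rw [hb₀] at hi
        simp only [mul_smul, hak, hb₀]
        linear_combination hi
      have hc : Commute T (ρ (a⁻¹ * (a * b₀ * a * b₀⁻¹))) := by
        rw [map_mul, map_inv]
        exact ((hacp j.val).inv_right).mul_right (hNc hk)
      have hmul (z : V) : ρ b₀ (ρ a z) = ρ (a⁻¹ * (a * b₀ * a * b₀⁻¹)) (ρ b₀ z) := by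
        simp only [← LinearEquiv.mul_apply, ← map_mul]
        congr 2; group
      have hc' (z : V) := LinearEquiv.congr_fun hc.inv_left.eq z
      have ha' (z : V) := LinearEquiv.congr_fun (hacp j.val).eq z
      simp only [LinearEquiv.mul_apply] at hc' ha' ⊢
      rw [hmul, hc', hb1 hy, ha', hmul]
    have key (g : N₂) :
        (ρ g * T * (ρ g)⁻¹ = T ∧ ∀ j : ZMod m, g • (j + 1) = g • j + 1) ∨
        (ρ g * T * (ρ g)⁻¹ = T⁻¹ ∧ ∀ j : ZMod m, g • (j + 1) = g • j - 1) := by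
      have hgmem : g ∈ Subgroup.closure ({g : N₂ | InKernel (m := m) N₂ g} ∪ {a₀, b₀}) :=
        hgen ▸ Subgroup.mem_top g
      induction hgmem using Subgroup.closure_induction with
      | mem g hg =>
        rcases hg with hg | rfl | rfl
        · exact Or.inl ⟨mul_inv_eq_iff_eq_mul.2 (hNc hg).symm.eq, fun j => by rw [hg, hg]⟩
        · exact Or.inl ⟨mul_inv_eq_iff_eq_mul.2 hac.symm.eq, fun j => by rw [ha₀, ha₀]⟩
        · exact Or.inr ⟨mul_inv_eq_iff_eq_mul.2 hbc.symm, fun j => by rw [hb₀, hb₀]; ring⟩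
      | one => exact Or.inl ⟨by simp, by simp⟩
      | mul x y _ _ hx hy =>
        have hconj : ρ (x * y) * T * (ρ (x * y))⁻¹ =
            ρ x * (ρ y * T * (ρ y)⁻¹) * (ρ x)⁻¹ := by rw [map_mul]; group
        have hsub (hx : ∀ j : ZMod m, x • (j + 1) = x • j + 1) (j : ZMod m) :
            x • (j - 1) = x • j - 1 := by
          have h := hx (j - 1); rw [sub_add_cancel] at h; rw [h]; ring
        have hsub' (hx : ∀ j : ZMod m, x • (j + 1) = x • j - 1) (j : ZMod m) :
            x • (j - 1) = x • j + 1 := by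
          have h := hx (j - 1); rw [sub_add_cancel] at h; rw [h]; ring
        rw [hconj]
        simp only [mul_smul]
        rcases hx with ⟨hx, hx'⟩ | ⟨hx, hx'⟩ <;> rcases hy with ⟨hy, hy'⟩ | ⟨hy, hy'⟩
        · exact Or.inl ⟨by rw [hy, hx], fun j => by rw [hy', hx']⟩
        · exact Or.inr ⟨by rw [hy, ← conj_inv, hx], fun j => by rw [hy', hsub hx']⟩
        · exact Or.inr ⟨by rw [hy, hx], fun j => by rw [hy', hx']⟩
        · exact Or.inl ⟨by rw [hy, ← conj_inv, hx, inv_inv], fun j => by rw [hy', hsub' hx']⟩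
      | inv x _ hx =>
        rw [map_inv, inv_inv]
        rcases hx with ⟨hx, hx'⟩ | ⟨hx, hx'⟩
        · refine Or.inl ⟨?_, fun j => ?_⟩
          · nth_rewrite 1 [← hx]; group
          · rw [inv_smul_eq_iff, hx', smul_inv_smul]
        · refine Or.inr ⟨?_, fun j => ?_⟩
          · have h : T = ρ x * T⁻¹ * (ρ x)⁻¹ := by rw [← conj_inv, hx, inv_inv]
            nth_rewrite 1 [h]
            group
          · have h := hx' (x⁻¹ • j - 1)
            rw [sub_add_cancel, smul_inv_smul] at h
            rw [inv_smul_eq_iff]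
            linear_combination h
    refine ⟨hTm, fun g j x _ => ?_⟩
    rcases key g with ⟨h, h'⟩ | ⟨h, h'⟩
    · rw [h, h', smul_inv_smul, add_sub_cancel_left, ZMod.val_one, pow_one]
    · rw [h, h', smul_inv_smul, show j - 1 - j = -1 by ring, ZMod.val_neg_of_ne_zero,
        ZMod.val_one, hTinv]

end EqClutch
end
end
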